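/- arXiv:2507.10467 — 6 statements merged into one kernel-verified Lean document; each statement's English description precedes it below -/
import Mathlib

section
/- For all positive integers q and k and every q-colorful graph (G,χ): if (G,χ) contains some (q,k)-segregated grid as a colorful minor, then the restrictive treewidth satisfies rtw(G,χ) ≥ k−1. -/
open SimpleGraph

/-- `(H, ψ)` is a colorful minor of `(G, χ)`. -/
def IsColorfulMinor {q : ℕ} {α β : Type*} (H : SimpleGraph α) (ψ : α → Finset (Fin q))
    (G : SimpleGraph β) (χ : β → Finset (Fin q)) : Prop :=
  ∃ B : α → Set β,
    (∀ v, (G.induce (B v)).Connected) ∧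
    (Pairwise fun u v => Disjoint (B u) (B v)) ∧
    (∀ u v, H.Adj u v → ∃ x ∈ B u, ∃ y ∈ B v, G.Adj x y) ∧
    (∀ v, ∀ c ∈ ψ v, ∃ x ∈ B v, c ∈ χ x)

/-- The `(m × m)`-grid: vertices are pairs `(row, column)`, adjacent when at
`ℓ₁`-distance `1`. -/
def gridGraph (m : ℕ) : SimpleGraph (Fin m × Fin m) :=
  SimpleGraph.fromRel fun a b =>
    (a.1 = b.1 ∧ a.2.val + 1 = b.2.val) ∨ (a.2 = b.2 ∧ a.1.val + 1 = b.1.val)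

/-- The coloring of the `(q,k)`-segregated grid realizing the permutation `π`
(`0`-based): a vertex `(r, c)` carries the single color `π(⌊r/k⌋)` if `c = 0`, and no
color otherwise. -/
def segPalette (q k : ℕ) (π : Equiv.Perm (Fin q))
    (v : Fin (q * k) × Fin (q * k)) : Finset (Fin q) :=
  Finset.univ.filter fun c =>
    v.2.val = 0 ∧ (π.symm c).val * k ≤ v.1.val ∧ v.1.val < ((π.symm c).val + 1) * k

/-- `C` is a connected component of `G − S`. -/
def IsComponentAvoiding {V : Type*} (G : SimpleGraph V) (S C : Set V) : Prop :=
  Disjoint C S ∧ (G.induce C).Connected ∧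
    ∀ x ∈ C, ∀ y, y ∉ S → G.Adj x y → y ∈ C

/-- The torso of `X` in `G`. -/
def torso {V : Type*} (G : SimpleGraph V) (X : Set V) : SimpleGraph X :=
  SimpleGraph.fromRel fun a b =>
    ∃ p : G.Walk a.1 b.1, ∀ v ∈ p.support, v ∉ X ∨ v = a.1 ∨ v = b.1

/-- `(T, β)` is a tree-decomposition of `G`. -/
structure IsTreeDecomp {V ι : Type*} (G : SimpleGraph V) (T : SimpleGraph ι)
    (β : ι → Set V) : Prop where
  isTree : T.IsTree
  covers_vertex : ∀ v : V, ∃ t : ι, v ∈ β t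
  covers_edge : ∀ ⦃u v : V⦄, G.Adj u v → ∃ t : ι, u ∈ β t ∧ v ∈ β t
  bags_connected : ∀ v : V, (T.induce {t : ι | v ∈ β t}).Connected

/-- `G` has treewidth at most `w`. -/
def TreewidthAtMost {V : Type*} (G : SimpleGraph V) (w : ℕ) : Prop :=
  ∃ (m : ℕ) (T : SimpleGraph (Fin m)) (β : Fin m → Set V),
    IsTreeDecomp G T β ∧ ∀ t, (β t).ncard ≤ w + 1

/-- The restrictive treewidth of `(G, χ)` is at most `w`: some vertex set `X` has a
torso of treewidth at most `w` while every component of `G − X` is restricted. -/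
def RtwAtMost {q n : ℕ} (G : SimpleGraph (Fin n)) (χ : Fin n → Finset (Fin q))
    (w : ℕ) : Prop :=
  ∃ X : Set (Fin n), TreewidthAtMost (torso G X) w ∧
    ∀ C : Set (Fin n), IsComponentAvoiding G X C → ∃ c : Fin q, ∀ x ∈ C, c ∉ χ x

/-- `y` can be reached from `x` by a walk of `G` inside `S`. -/
def Rch {V : Type*} (G : SimpleGraph V) (S : Set V) (x y : V) : Prop :=
  ∃ p : G.Walk x y, ∀ v ∈ p.support, v ∈ S

theorem Rch.rfl' {V : Type*} {G : SimpleGraph V} {S : Set V} {x : V} (h : x ∈ S) :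
    Rch G S x x := ⟨Walk.nil, by simpa using h⟩

theorem Rch.symm' {V : Type*} {G : SimpleGraph V} {S : Set V} {x y : V} (h : Rch G S x y) :
    Rch G S y x := by
  obtain ⟨p, hp⟩ := h
  exact ⟨p.reverse, by simpa using hp⟩

theorem Rch.trans' {V : Type*} {G : SimpleGraph V} {S : Set V} {x y z : V}
    (h : Rch G S x y) (h2 : Rch G S y z) : Rch G S x z := by
  obtain ⟨p, hp⟩ := h
  obtain ⟨p2, hp2⟩ := h2
  refine ⟨p.append p2, fun v hv => ?_⟩
  rw [Walk.mem_support_append_iff] at hv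
  exact hv.elim (hp v) (hp2 v)

theorem Rch.mono' {V : Type*} {G : SimpleGraph V} {S S' : Set V} {x y : V}
    (h : Rch G S x y) (hs : S ⊆ S') : Rch G S' x y := by
  obtain ⟨p, hp⟩ := h
  exact ⟨p, fun v hv => hs (hp v hv)⟩

theorem Rch.adj' {V : Type*} {G : SimpleGraph V} {S : Set V} {x y : V}
    (h : G.Adj x y) (hx : x ∈ S) (hy : y ∈ S) : Rch G S x y := by
  refine ⟨h.toWalk, fun v hv => ?_⟩
  simp at hv
  rcases hv with rfl | rfl <;> assumption

theorem Rch.left' {V : Type*} {G : SimpleGraph V} {S : Set V} {x y : V}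
    (h : Rch G S x y) : x ∈ S := by
  obtain ⟨p, hp⟩ := h
  exact hp _ p.start_mem_support

theorem Rch.right' {V : Type*} {G : SimpleGraph V} {S : Set V} {x y : V}
    (h : Rch G S x y) : y ∈ S := by
  obtain ⟨p, hp⟩ := h
  exact hp _ p.end_mem_support

theorem rch_of_connected {V : Type*} {G : SimpleGraph V} {S : Set V}
    (h : (G.induce S).Connected) {x y : V} (hx : x ∈ S) (hy : y ∈ S) : Rch G S x y := by
  obtain ⟨p⟩ := h.preconnected ⟨x, hx⟩ ⟨y, hy⟩
  have key : ∀ (a b : S) (p : (G.induce S).Walk a b), Rch G S a.1 b.1 := by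
    intro a b p
    induction p with
    | nil => exact Rch.rfl' (Subtype.property _)
    | @cons a a' b h p ih =>
      have h' : G.Adj a.1 a'.1 := h
      exact (Rch.adj' h' a.2 a'.2).trans' ih
  exact key _ _ p

theorem connected_of_rch {V : Type*} {G : SimpleGraph V} {S : Set V} {x : V} (hx : x ∈ S)
    (h : ∀ y ∈ S, Rch G S x y) : (G.induce S).Connected := by
  rw [connected_iff_exists_forall_reachable]
  refine ⟨⟨x, hx⟩, fun ⟨y, hy⟩ => ?_⟩
  obtain ⟨p, hp⟩ := h y hy
  exact ⟨p.induce S hp⟩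

/-- Convex vertex sets of a tree. -/
def Cvx {V : Type*} (T : SimpleGraph V) (S : Set V) : Prop :=
  ∀ x ∈ S, ∀ y ∈ S, ∀ p : T.Walk x y, p.IsPath → ∀ v ∈ p.support, v ∈ S

theorem cvx_of_rch {V : Type*} {T : SimpleGraph V} (hT : T.IsTree) {S : Set V}
    (h : ∀ x ∈ S, ∀ y ∈ S, Rch T S x y) : Cvx T S := by
  classical
  intro x hx y hy p hp v hv
  obtain ⟨w, hw⟩ := h x hx y hy
  have : p = w.bypass := by
    have := hT.isAcyclic.path_unique ⟨p, hp⟩ ⟨w.bypass, w.bypass_isPath⟩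
    exact congrArg Subtype.val this
  subst this
  exact hw v (w.support_bypass_subset hv)

/-- Last vertex of a path in `A`. -/
theorem last_hit {V : Type*} {T : SimpleGraph V} {A : Set V} {x y : V} (p : T.Walk x y)
    (hp : p.IsPath) (hx : x ∈ A) :
    ∃ m ∈ p.support, m ∈ A ∧ ∃ r : T.Walk m y, r.IsPath ∧ ∀ v ∈ r.support, v ∈ A → v = m := by
  induction p with
  | nil => exact ⟨_, by simp, hx, Walk.nil, by simp, by simp⟩
  | @cons u v w h p ih =>
    rw [Walk.cons_isPath_iff] at hp
    by_cases hA : ∃ z ∈ p.support, z ∈ A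
    · by_cases hv : v ∈ A
      · obtain ⟨m, hm, h2⟩ := ih hp.1 hv
        exact ⟨m, by simp [hm], h2⟩
      · classical
        -- induct on the tail with a weaker hypothesis
        have key : ∀ (a b : V) (p : T.Walk a b), p.IsPath → (∃ z ∈ p.support, z ∈ A) →
            ∃ m ∈ p.support, m ∈ A ∧ ∃ r : T.Walk m b, r.IsPath ∧
              ∀ v ∈ r.support, v ∈ A → v = m := by
          intro a b p
          induction p with
          | nil =>
            rintro - ⟨z, hz, hzA⟩
            simp at hz
            subst hz
            exact ⟨_, by simp, hzA, Walk.nil, by simp, by simp⟩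
          | @cons a a' b h p ih2 =>
            intro hp hz
            have hp' := hp
            rw [Walk.cons_isPath_iff] at hp
            by_cases hA : ∃ z ∈ p.support, z ∈ A
            · obtain ⟨m, hm, h2⟩ := ih2 hp.1 hA
              exact ⟨m, by simp [hm], h2⟩
            · push Not at hA
              obtain ⟨z, hz, hzA⟩ := hz
              have hza : z = a := by
                rw [Walk.support_cons, List.mem_cons] at hz
                rcases hz with hz | hz
                · exact hz
                · exact absurd hzA (hA z hz)
              subst hza
              refine ⟨z, by simp, hzA, Walk.cons h p, hp', ?_⟩
              intro v hv hvA
              rw [Walk.support_cons, List.mem_cons] at hv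
              rcases hv with hv | hv
              · exact hv
              · exact absurd hvA (hA v hv)
        obtain ⟨m, hm, h2⟩ := key _ _ p hp.1 hA
        exact ⟨m, by simp [hm], h2⟩
    · push Not at hA
      refine ⟨u, by simp, hx, Walk.cons h p, ?_, ?_⟩
      · rw [Walk.cons_isPath_iff]; exact hp
      intro v hv hvA
      rw [Walk.support_cons, List.mem_cons] at hv
      rcases hv with hv | hv
      · exact hv
      · exact absurd hvA (hA v hv)

theorem helly3 {V : Type*} {T : SimpleGraph V} (hT : T.IsTree) {A B C : Set V}
    (hA : Cvx T A) (hB : Cvx T B) (hC : Cvx T C)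
    (h1 : (A ∩ B).Nonempty) (h2 : (B ∩ C).Nonempty) (h3 : (A ∩ C).Nonempty) :
    (A ∩ B ∩ C).Nonempty := by
  classical
  obtain ⟨x, hxA, hxB⟩ := h1
  obtain ⟨y, hyB, hyC⟩ := h2
  obtain ⟨z, hzA, hzC⟩ := h3
  obtain ⟨p, hp⟩ := (hT.connected.preconnected x y).exists_isPath
  obtain ⟨m, hm, hmA, r, hr, hrA⟩ := last_hit p hp hxA
  obtain ⟨s, hs⟩ := (hT.connected.preconnected z m).exists_isPath
  have hsA := hA z hzA m hmA s hs
  have hmB := hB x hxB y hyB p hp m hm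
  have hpath : (s.append r).IsPath := by
    rw [Walk.isPath_def, Walk.support_append, List.nodup_append]
    have hr' := hr.support_nodup
    rw [Walk.support_eq_cons, List.nodup_cons] at hr'
    refine ⟨hs.support_nodup, hr'.2, ?_⟩
    intro a ha b hb hab
    subst hab
    have : a = m := hrA a (List.mem_of_mem_tail hb) (hsA a ha)
    subst this
    exact hr'.1 hb
  refine ⟨m, ⟨hmA, hmB⟩, hC z hzC y hyC _ hpath m ?_⟩
  rw [Walk.mem_support_append_iff]
  exact Or.inl s.end_mem_support

theorem Cvx.inter' {V : Type*} {T : SimpleGraph V} {A B : Set V}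
    (hA : Cvx T A) (hB : Cvx T B) : Cvx T (A ∩ B) :=
  fun x hx y hy p hp v hv => ⟨hA x hx.1 y hy.1 p hp v hv, hB x hx.2 y hy.2 p hp v hv⟩

theorem helly {V ι : Type*} {T : SimpleGraph V} (hT : T.IsTree) (s : Finset ι) :
    ∀ F : ι → Set V, s.Nonempty → (∀ i ∈ s, Cvx T (F i)) →
      (∀ i ∈ s, ∀ j ∈ s, (F i ∩ F j).Nonempty) → ∃ t, ∀ i ∈ s, t ∈ F i := by
  classical
  induction s using Finset.induction_on with
  | empty => intro F h; simp at h
  | insert a s ha ih =>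
    intro F _ hc hi
    rcases s.eq_empty_or_nonempty with rfl | hs
    · obtain ⟨t, ht, _⟩ := hi a (by simp) a (by simp)
      exact ⟨t, by simpa using ht⟩
    · obtain ⟨t, ht⟩ := ih (fun i => F i ∩ F a) hs
        (fun i hi => (hc i (by simp [hi])).inter' (hc a (by simp))) (by
          intro i hi' j hj'
          obtain ⟨t, ⟨h1, h2⟩, h3⟩ := helly3 hT (hc i (by simp [hi'])) (hc j (by simp [hj']))
            (hc a (by simp)) (hi i (by simp [hi']) j (by simp [hj']))
            (hi j (by simp [hj']) a (by simp)) (hi i (by simp [hi']) a (by simp))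
          exact ⟨t, ⟨h1, h3⟩, h2, h3⟩)
      refine ⟨t, fun i hi' => ?_⟩
      rw [Finset.mem_insert] at hi'
      rcases hi' with rfl | hi'
      · obtain ⟨j, hj⟩ := hs
        exact (ht j hj).2
      · exact (ht i hi').1

theorem trace_rch {V ι : Type*} {G : SimpleGraph V} {T : SimpleGraph ι} {β : ι → Set V}
    (h : IsTreeDecomp G T β) {S : Set V} {u v : V} (p : G.Walk u v) :
    (∀ x ∈ p.support, x ∈ S) → ∀ s t, u ∈ β s → v ∈ β t →
      Rch T {t | ∃ x ∈ S, x ∈ β t} s t := by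
  have one : ∀ u ∈ S, ∀ s t, u ∈ β s → u ∈ β t → Rch T {t | ∃ x ∈ S, x ∈ β t} s t := by
    intro u hu s t hs ht
    exact (rch_of_connected (h.bags_connected u) hs ht).mono' (fun t ht => ⟨u, hu, ht⟩)
  induction p with
  | nil => intro hS s t hs ht; exact one _ (hS _ (by simp)) s t hs ht
  | cons hadj p ih =>
    intro hS s t hs ht
    obtain ⟨t', h1, h2⟩ := h.covers_edge hadj
    exact (one _ (hS _ (by simp)) s t' hs h1).trans'
      (ih (fun x hx => hS x (by simp [hx])) t' t h2 ht)

theorem bramble_bag {V ι κ : Type*} [Fintype κ] [Nonempty κ] {G : SimpleGraph V}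
    {T : SimpleGraph ι} {β : ι → Set V} (h : IsTreeDecomp G T β) (A : κ → Set V)
    (hA : ∀ i, ∀ x ∈ A i, ∀ y ∈ A i, Rch G (A i) x y)
    (ht : ∀ i j, ∃ a ∈ A i, ∃ b ∈ A j, a = b ∨ G.Adj a b) :
    ∃ t, ∀ i, ∃ x ∈ A i, x ∈ β t := by
  obtain ⟨t, ht⟩ := helly h.isTree (Finset.univ : Finset κ)
    (fun i => {t | ∃ x ∈ A i, x ∈ β t}) Finset.univ_nonempty
    (by
      intro i _
      refine cvx_of_rch h.isTree ?_
      rintro s ⟨x, hx, hxs⟩ t ⟨y, hy, hyt⟩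
      obtain ⟨p, hp⟩ := hA i x hx y hy
      exact trace_rch h p hp s t hxs hyt)
    (by
      intro i _ j _
      obtain ⟨a, ha, b, hb, hab⟩ := ht i j
      rcases hab with rfl | hab
      · obtain ⟨t, ht⟩ := h.covers_vertex a
        exact ⟨t, ⟨a, ha, ht⟩, ⟨a, hb, ht⟩⟩
      · obtain ⟨t, h1, h2⟩ := h.covers_edge hab
        exact ⟨t, ⟨a, ha, h1⟩, ⟨b, hb, h2⟩⟩)
  exact ⟨t, fun i => ht i (Finset.mem_univ i)⟩

theorem torso_rch {V : Type*} {G : SimpleGraph V} {X A : Set V} {x y : V} (p : G.Walk x y)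
    (hy : y ∈ X) : (∀ v ∈ p.support, v ∈ A) → ∀ a (ha : a ∈ X), a ∈ A →
      ∀ w : G.Walk a x, (∀ v ∈ w.support, v ∉ X ∨ v = a) →
      Rch (torso G X) {z | z.1 ∈ A} ⟨a, ha⟩ ⟨y, hy⟩ := by
  induction p with
  | nil =>
    intro hS a ha haA w hw
    rcases hw _ w.end_mem_support with h | h
    · exact absurd hy h
    · subst h
      exact Rch.rfl' haA
  | @cons x x' y hadj p ih =>
    intro hS a ha haA w hw
    have hS' : ∀ v ∈ p.support, v ∈ A := fun v hv => hS v (by simp [hv])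
    have hx'A : x' ∈ A := hS' _ p.start_mem_support
    by_cases hx' : x' ∈ X
    · have step := ih hy hS' x' hx' hx'A Walk.nil (by simp)
      by_cases hax : a = x'
      · subst hax; exact step
      · refine Rch.trans' (Rch.adj' ?_ haA hx'A) step
        rw [torso, SimpleGraph.fromRel_adj]
        refine ⟨fun h => hax (congrArg Subtype.val h), Or.inl ⟨w.concat hadj, ?_⟩⟩
        intro v hv
        rw [Walk.support_concat] at hv
        simp only [List.mem_append, List.mem_singleton] at hv
        rcases hv with hv | hv
        · rcases hw v hv with h | h
          · exact Or.inl h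
          · exact Or.inr (Or.inl h)
        · exact Or.inr (Or.inr hv)
    · refine ih hy hS' a ha haA (w.concat hadj) ?_
      intro v hv
      rw [Walk.support_concat] at hv
      simp only [List.mem_append, List.mem_singleton] at hv
      rcases hv with hv | hv
      · exact hw v hv
      · subst hv; exact Or.inl hx'

theorem first_hit {V : Type*} {G : SimpleGraph V} {X A : Set V} {x y : V} (p : G.Walk x y)
    (hy : y ∈ X) : (∀ v ∈ p.support, v ∈ A) →
      ∃ a ∈ X, a ∈ A ∧ ∃ w : G.Walk x a, ∀ v ∈ w.support, v ∉ X ∨ v = a := by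
  induction p with
  | nil => intro hS; exact ⟨_, hy, hS _ (by simp), Walk.nil, by simp⟩
  | @cons x x' y hadj p ih =>
    intro hS
    by_cases hx : x ∈ X
    · exact ⟨x, hx, hS _ (by simp), Walk.nil, by simp⟩
    · obtain ⟨a, ha, haA, w, hw⟩ := ih hy (fun v hv => hS v (by simp [hv]))
      refine ⟨a, ha, haA, Walk.cons hadj w, ?_⟩
      intro v hv
      rw [Walk.support_cons, List.mem_cons] at hv
      rcases hv with rfl | hv
      · exact Or.inl hx
      · exact hw v hv

/-- Sets of a bramble of `G` that all meet `X`, restricted to the torso. -/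
theorem torso_bramble {V κ : Type*} [Fintype κ] [Nonempty κ] {G : SimpleGraph V} {X : Set V}
    {ι : Type*} {T : SimpleGraph ι} {β : ι → Set X} (h : IsTreeDecomp (torso G X) T β)
    (A : κ → Set V) (hA : ∀ i, ∀ x ∈ A i, ∀ y ∈ A i, Rch G (A i) x y)
    (hX : ∀ i, (A i ∩ X).Nonempty) (ht : ∀ i j, (A i ∩ A j).Nonempty) :
    ∃ t, ∀ i, ∃ x : X, x.1 ∈ A i ∧ x ∈ β t := by
  refine bramble_bag h (fun i => {z : X | z.1 ∈ A i}) ?_ ?_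
  · rintro i ⟨x, hxX⟩ hx ⟨y, hyX⟩ hy
    obtain ⟨p, hp⟩ := hA i x hx y hy
    exact torso_rch p hyX hp x hxX hx Walk.nil (by simp)
  · intro i j
    obtain ⟨v, hvi, hvj⟩ := ht i j
    obtain ⟨a0, ha0, ha0X⟩ := hX i
    obtain ⟨b0, hb0, hb0X⟩ := hX j
    obtain ⟨p, hp⟩ := hA i v hvi a0 ha0
    obtain ⟨p', hp'⟩ := hA j v hvj b0 hb0
    obtain ⟨a, haX, haA, w, hw⟩ := first_hit p ha0X hp
    obtain ⟨b, hbX, hbA, w', hw'⟩ := first_hit p' hb0X hp'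
    refine ⟨⟨a, haX⟩, haA, ⟨b, hbX⟩, hbA, ?_⟩
    by_cases hab : a = b
    · left; subst hab; rfl
    · right
      rw [torso, SimpleGraph.fromRel_adj]
      refine ⟨fun h => hab (congrArg Subtype.val h), Or.inl ⟨w.reverse.append w', ?_⟩⟩
      intro v hv
      rw [Walk.mem_support_append_iff, Walk.support_reverse, List.mem_reverse] at hv
      rcases hv with hv | hv
      · rcases hw v hv with h | h
        · exact Or.inl h
        · exact Or.inr (Or.inl h)
      · rcases hw' v hv with h | h
        · exact Or.inl h
        · exact Or.inr (Or.inr h)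

theorem meets_of_restricted {q n : ℕ} {G : SimpleGraph (Fin n)} {χ : Fin n → Finset (Fin q)}
    {X : Set (Fin n)}
    (hX : ∀ C : Set (Fin n), IsComponentAvoiding G X C → ∃ c : Fin q, ∀ x ∈ C, c ∉ χ x)
    {A : Set (Fin n)} (hne : A.Nonempty) (hA : ∀ x ∈ A, ∀ y ∈ A, Rch G A x y)
    (hc : ∀ c, ∃ x ∈ A, c ∈ χ x) : (A ∩ X).Nonempty := by
  classical
  by_contra hcon
  have hAX : A ⊆ Xᶜ := fun x hx hxX => hcon ⟨x, hx, hxX⟩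
  obtain ⟨x0, hx0⟩ := hne
  let C : Set (Fin n) := {y | Rch G Xᶜ x0 y}
  have hC : IsComponentAvoiding G X C := by
    refine ⟨?_, ?_, ?_⟩
    · rw [Set.disjoint_left]
      intro y hy
      exact hy.right'
    · refine connected_of_rch (x := x0) (Rch.rfl' (hAX hx0)) ?_
      rintro y ⟨p, hp⟩
      refine ⟨p, fun v hv => ?_⟩
      exact ⟨p.takeUntil v hv, fun u hu => hp u (p.support_takeUntil_subset hv hu)⟩
    · intro x hx y hy hadj
      exact Rch.trans' hx (Rch.adj' hadj hx.right' hy)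
  obtain ⟨c, hcC⟩ := hX C hC
  obtain ⟨x, hx, hxc⟩ := hc c
  exact hcC x ((hA x0 hx0 x hx).mono' hAX) hxc

theorem grid_row {m : ℕ} (r c c' : Fin m) :
    Rch (gridGraph m) {v | v.1 = r} (r, c) (r, c') := by
  have key : ∀ (j : ℕ) (hj : j < m) (h0 : 0 < m),
      Rch (gridGraph m) {v | v.1 = r} (r, ⟨0, h0⟩) (r, ⟨j, hj⟩) := by
    intro j
    induction j with
    | zero => intro _ _; exact Rch.rfl' rfl
    | succ j ih =>
      intro hj h0
      refine (ih (by omega) h0).trans' (Rch.adj' ?_ rfl rfl)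
      rw [gridGraph, SimpleGraph.fromRel_adj]
      simp
  have h0 : 0 < m := c.pos
  exact (key c c.2 h0).symm'.trans' (key c' c'.2 h0)

theorem grid_col {m : ℕ} (r r' c : Fin m) :
    Rch (gridGraph m) {v | v.2 = c} (r, c) (r', c) := by
  have key : ∀ (j : ℕ) (hj : j < m) (h0 : 0 < m),
      Rch (gridGraph m) {v | v.2 = c} (⟨0, h0⟩, c) (⟨j, hj⟩, c) := by
    intro j
    induction j with
    | zero => intro _ _; exact Rch.rfl' rfl
    | succ j ih =>
      intro hj h0
      refine (ih (by omega) h0).trans' (Rch.adj' ?_ rfl rfl)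
      rw [gridGraph, SimpleGraph.fromRel_adj]
      simp
  have h0 : 0 < m := c.pos
  exact (key r r.2 h0).symm'.trans' (key r' r'.2 h0)

theorem minor_rch {α β : Type*} {H : SimpleGraph α} {G : SimpleGraph β} {B : α → Set β}
    (hB : ∀ v, (G.induce (B v)).Connected)
    (hadj : ∀ u v, H.Adj u v → ∃ x ∈ B u, ∃ y ∈ B v, G.Adj x y) {S : Set α} {u v : α}
    (p : H.Walk u v) : (∀ x ∈ p.support, x ∈ S) → ∀ x ∈ B u, ∀ y ∈ B v,
      Rch G {z | ∃ a ∈ S, z ∈ B a} x y := by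
  have one : ∀ u ∈ S, ∀ x ∈ B u, ∀ y ∈ B u, Rch G {z | ∃ a ∈ S, z ∈ B a} x y := by
    intro u hu x hx y hy
    exact (rch_of_connected (hB u) hx hy).mono' (fun z hz => ⟨u, hu, hz⟩)
  induction p with
  | nil => intro hS; exact one _ (hS _ (by simp))
  | @cons u u' v h p ih =>
    intro hS x hx y hy
    obtain ⟨a, ha, b, hb, hab⟩ := hadj _ _ h
    have hu : u ∈ S := hS _ (by simp)
    have hu' : u' ∈ S := hS _ (by simp)
    exact ((one _ hu x hx a ha).trans' (Rch.adj' hab ⟨u, hu, ha⟩ ⟨u', hu', hb⟩)).trans'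
      (ih (fun z hz => hS z (by simp [hz])) b hb y hy)

theorem exists_missed {V : Type*} {k : ℕ} {S : Set V} (hfin : S.Finite) (hS : S.ncard < k)
    (R : Fin k → Set V) (hR : ∀ i j x, x ∈ R i → x ∈ R j → i = j) :
    ∃ j, ∀ x ∈ S, x ∉ R j := by
  by_contra hcon
  push Not at hcon
  choose f hf hfR using hcon
  have hinj : Function.Injective f := by
    intro i j hij
    exact hR i j (f i) (hfR i) (hij ▸ hfR j)
  have h1 : (Set.range f).ncard = k := by
    rw [← Set.image_univ, Set.ncard_image_of_injective _ hinj, Set.ncard_univ]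
    simp
  have h2 : (Set.range f).ncard ≤ S.ncard :=
    Set.ncard_le_ncard (by rintro _ ⟨i, rfl⟩; exact hf i) hfin
  omega

/-- If a `q`-colorful graph contains some `(q,k)`-segregated grid as a colorful minor,
then its restrictive treewidth is at least `k − 1`. -/
theorem segregated_grid_lower_bound (q k : ℕ) (hq : 0 < q) (hk : 0 < k)
    {n : ℕ} (G : SimpleGraph (Fin n)) (χ : Fin n → Finset (Fin q))
    (hminor : ∃ π : Equiv.Perm (Fin q),
      IsColorfulMinor (gridGraph (q * k)) (segPalette q k π) G χ) :
    ∀ w : ℕ, RtwAtMost G χ w → k - 1 ≤ w := by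
  intro w hw
  by_contra hlt
  have hwk : w + 1 < k := by omega
  obtain ⟨X, ⟨m, T, β, hdec, hbag⟩, hX⟩ := hw
  obtain ⟨π, B, hconn, hdisj, hadj, hcol⟩ := hminor
  have huniq : ∀ u v x, x ∈ B u → x ∈ B v → u = v := by
    intro u v x hu hv
    by_contra hne
    exact Set.disjoint_left.1 (hdisj hne) hu hv
  have hqk : 0 < q * k := Nat.mul_pos hq hk
  have hkqk : k ≤ q * k := Nat.le_mul_of_pos_left k hq
  have hneB : ∀ v, (B v).Nonempty := by
    intro v
    obtain ⟨x⟩ := (hconn v).nonempty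
    exact ⟨x.1, x.2⟩
  let row : Fin q → Fin k → Fin (q * k) := fun i j => finProdFinEquiv (i, j)
  let S : (Fin q → Fin k) × Fin (q * k) → Set (Fin (q * k) × Fin (q * k)) :=
    fun d => {v | v.2 = d.2 ∨ ∃ i, v.1 = row i (d.1 i)}
  let A : (Fin q → Fin k) × Fin (q * k) → Set (Fin n) := fun d => {z | ∃ a ∈ S d, z ∈ B a}
  have hSto : ∀ d, ∀ u ∈ S d, ∃ r, Rch (gridGraph (q * k)) (S d) u (r, d.2) := by
    rintro d ⟨r, c⟩ hu
    refine ⟨r, ?_⟩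
    rcases hu with hu | ⟨i, hi⟩
    · have hu' : c = d.2 := hu
      subst hu'
      exact Rch.rfl' (Or.inl rfl)
    · refine (grid_row r c d.2).mono' ?_
      intro v hv
      have hv' : v.1 = r := hv
      exact Or.inr ⟨i, hv'.trans hi⟩
  have hSconn : ∀ d, ∀ u ∈ S d, ∀ v ∈ S d, Rch (gridGraph (q * k)) (S d) u v := by
    intro d u hu v hv
    obtain ⟨r, hr⟩ := hSto d u hu
    obtain ⟨r', hr'⟩ := hSto d v hv
    exact (hr.trans' ((grid_col r r' d.2).mono' (fun v hv => Or.inl hv))).trans' hr'.symm'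
  have hAconn : ∀ d, ∀ x ∈ A d, ∀ y ∈ A d, Rch G (A d) x y := by
    rintro d x ⟨u, hu, hx⟩ y ⟨v, hv, hy⟩
    obtain ⟨p, hp⟩ := hSconn d u hu v hv
    exact minor_rch hconn hadj p hp x hx y hy
  have hAint : ∀ d e, (A d ∩ A e).Nonempty := by
    intro d e
    obtain ⟨x, hx⟩ := hneB (row ⟨0, hq⟩ (d.1 ⟨0, hq⟩), e.2)
    exact ⟨x, ⟨_, Or.inr ⟨_, rfl⟩, hx⟩, ⟨_, Or.inl rfl, hx⟩⟩
  have hAX : ∀ d, (A d ∩ X).Nonempty := by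
    intro d
    refine meets_of_restricted hX ((hAint d d).mono Set.inter_subset_left) (hAconn d) ?_
    intro c
    obtain ⟨x, hx, hxc⟩ := hcol (row (π.symm c) (d.1 (π.symm c)), ⟨0, hqk⟩) c (by
      have := (d.1 (π.symm c)).2
      simp only [segPalette, row, Finset.mem_filter, Finset.mem_univ, true_and,
        finProdFinEquiv_apply_val]
      constructor <;> nlinarith)
    exact ⟨x, ⟨_, Or.inr ⟨_, rfl⟩, hx⟩, hxc⟩
  haveI : Nonempty ((Fin q → Fin k) × Fin (q * k)) := ⟨(fun _ => ⟨0, hk⟩, ⟨0, hqk⟩)⟩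
  obtain ⟨t, ht⟩ := torso_bramble hdec A hAconn hAX hAint
  have hcard : (β t).ncard < k := lt_of_le_of_lt (hbag t) hwk
  have hfin : (β t).Finite := Set.toFinite _
  have hrows : ∀ i : Fin q, ∃ j : Fin k, ∀ x ∈ β t, ∀ c, x.1 ∉ B (row i j, c) := by
    intro i
    obtain ⟨j, hj⟩ := exists_missed hfin hcard
      (fun j => {x : X | ∃ c, x.1 ∈ B (row i j, c)}) (by
        rintro j j' x ⟨c, hc⟩ ⟨c', hc'⟩
        have h := congrArg Prod.fst (huniq _ _ _ hc hc')
        have h2 := finProdFinEquiv.injective h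
        exact congrArg Prod.snd h2)
    exact ⟨j, fun x hx c hc => hj x hx ⟨c, hc⟩⟩
  choose rr hrr using hrows
  obtain ⟨j, hj⟩ := exists_missed hfin hcard
    (fun j => {x : X | ∃ r, x.1 ∈ B (r, Fin.castLE hkqk j)}) (by
      rintro j j' x ⟨c, hc⟩ ⟨c', hc'⟩
      have h := congrArg Prod.snd (huniq _ _ _ hc hc')
      exact Fin.castLE_injective hkqk h)
  obtain ⟨x, ⟨⟨r, c⟩, hv, hx⟩, hxt⟩ := ht (rr, Fin.castLE hkqk j)
  rcases hv with hv | ⟨i, hv⟩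
  · have hv' : c = Fin.castLE hkqk j := hv
    subst hv'
    exact hj x hxt ⟨r, hx⟩
  · have hv' : r = row i (rr i) := hv
    subst hv'
    exact hrr i x hxt c hx
end

section
/- For all positive integers q, k, and r, and every permutation π of {1,…,q}, the (q,kr)-segregated grid realizing π contains a half-integral packing of size k of the (q,r)-segregated grid realizing π. -/
open SimpleGraph

lemma shp_conn {V : Type*} (H : SimpleGraph V) (c : V) (d : V → ℕ)
    (h : ∀ v, v ≠ c → ∃ w, H.Adj v w ∧ d w < d v) : H.Connected := by
  have key : ∀ n, ∀ v, d v = n → H.Reachable v c := by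
    intro n
    induction n using Nat.strong_induction_on with
    | _ n ih =>
      intro v hv
      by_cases hc : v = c
      · subst hc; exact Reachable.refl _
      · obtain ⟨w, hw, hd⟩ := h v hc
        exact hw.reachable.trans (ih (d w) (by omega) w rfl)
  have : Nonempty V := ⟨c⟩
  exact ⟨fun u v => (key _ u rfl).trans (key _ v rfl).symm⟩

def shpI (f : ℕ → ℕ) (s x : ℕ) : Prop := (s = 0 ∨ f s ≤ x) ∧ x < f (s + 1)

lemma shpI_disj {f : ℕ → ℕ} (hf : StrictMono f) {s s' x : ℕ} (h : shpI f s x)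
    (h' : shpI f s' x) : s = s' := by
  obtain ⟨h1, h2⟩ := h
  obtain ⟨h3, h4⟩ := h'
  by_contra hne
  rcases Nat.lt_or_gt_of_ne hne with hlt | hlt
  · have := hf.monotone (show s + 1 ≤ s' from hlt)
    omega
  · have := hf.monotone (show s' + 1 ≤ s from hlt)
    omega

lemma shpI_self {f : ℕ → ℕ} (hf : StrictMono f) (s : ℕ) : shpI f s (f s) :=
  ⟨Or.inr le_rfl, hf (Nat.lt_succ_self s)⟩

lemma shpI_pred {f : ℕ → ℕ} (hf : StrictMono f) (s : ℕ) : shpI f s (f (s + 1) - 1) := by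
  have := hf (Nat.lt_succ_self s)
  simp only [Nat.succ_eq_add_one] at this
  exact ⟨Or.inr (by omega), by omega⟩

lemma shpI_step {f : ℕ → ℕ} (hf : StrictMono f) {s x : ℕ} (h : shpI f s x) (hne : x ≠ f s) :
    ∃ y, shpI f s y ∧ (x + 1 = y ∨ y + 1 = x) ∧ y ≤ max x (f s) ∧
      (y - f s) + (f s - y) < (x - f s) + (f s - x) := by
  have := hf (Nat.lt_succ_self s)
  simp only [Nat.succ_eq_add_one] at this
  obtain ⟨h1, h2⟩ := h
  rcases Nat.lt_or_gt_of_ne hne with hlt | hlt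
  · exact ⟨x + 1, ⟨by omega, by omega⟩, by omega, by omega, by omega⟩
  · exact ⟨x - 1, ⟨by omega, by omega⟩, by omega, by omega, by omega⟩

lemma shp_adj {N : ℕ} (a b : Fin N × Fin N) :
    (gridGraph N).Adj a b ↔
      (a.1.val = b.1.val ∧ (a.2.val + 1 = b.2.val ∨ b.2.val + 1 = a.2.val)) ∨
      (a.2.val = b.2.val ∧ (a.1.val + 1 = b.1.val ∨ b.1.val + 1 = a.1.val)) := by
  simp only [gridGraph, SimpleGraph.fromRel_adj, ne_eq, Prod.ext_iff, Fin.ext_iff]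
  omega

def shpB (f g : ℕ → ℕ) (s t x y : ℕ) : Prop :=
  shpI f s x ∧ shpI g t y ∧ (x = f s ∨ y = g t)

lemma shp_minor {q n N : ℕ} (f g : ℕ → ℕ) (hf : StrictMono f) (hg : StrictMono g)
    (hfN : ∀ s < n, f s < N) (hgN : ∀ s < n, g s < N)
    (ψ : Fin n × Fin n → Finset (Fin q)) (χ : Fin N × Fin N → Finset (Fin q))
    (hψ : ∀ v, ∀ c ∈ ψ v, v.2.val = 0 ∧
      ∃ x : Fin N × Fin N, x.1.val = f v.1 ∧ x.2.val = 0 ∧ c ∈ χ x) :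
    IsColorfulMinor (gridGraph n) ψ
      ((gridGraph N).induce {p | (∃ s < n, p.1.val = f s) ∨ ∃ t < n, p.2.val = g t})
      (fun x => χ x.1) := by
  have hJ : ∀ (s t : Fin n) (p : Fin N × Fin N), shpB f g s t p.1 p.2 →
      p ∈ {p : Fin N × Fin N | (∃ s < n, p.1.val = f s) ∨ ∃ t < n, p.2.val = g t} := by
    rintro s t p ⟨-, -, h | h⟩
    · exact Or.inl ⟨s, s.2, h⟩
    · exact Or.inr ⟨t, t.2, h⟩
  have hE : ∀ u v : Fin n × Fin n,
      ((u.1.val = v.1.val ∧ u.2.val + 1 = v.2.val) ∨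
        (u.2.val = v.2.val ∧ u.1.val + 1 = v.1.val)) →
      ∃ x y : Fin N × Fin N, shpB f g u.1 u.2 x.1 x.2 ∧ shpB f g v.1 v.2 y.1 y.2 ∧
        (gridGraph N).Adj x y := by
    rintro ⟨s, t⟩ ⟨s', t'⟩ h
    simp only at h
    rcases h with ⟨h1, h2⟩ | ⟨h1, h2⟩
    · have a1 := hfN s s.2
      have a2 := hgN t' t'.2
      have a3 := hg (show t.val < t'.val by omega)
      refine ⟨(⟨f s, a1⟩, ⟨g t' - 1, by omega⟩), (⟨f s, a1⟩, ⟨g t', a2⟩), ?_, ?_, ?_⟩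
      · refine ⟨shpI_self hf _, ?_, Or.inl rfl⟩
        have := shpI_pred hg t.val
        rw [h2] at this
        exact this
      · refine ⟨?_, shpI_self hg _, Or.inr rfl⟩
        simp only [h1]
        exact shpI_self hf _
      · exact (shp_adj _ _).2 (Or.inl ⟨rfl, Or.inl (Nat.sub_add_cancel (by omega))⟩)
    · have a1 := hgN t t.2
      have a2 := hfN s' s'.2
      have a3 := hf (show s.val < s'.val by omega)
      refine ⟨(⟨f s' - 1, by omega⟩, ⟨g t, a1⟩), (⟨f s', a2⟩, ⟨g t, a1⟩), ?_, ?_, ?_⟩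
      · refine ⟨?_, shpI_self hg _, Or.inr rfl⟩
        have := shpI_pred hf s.val
        rw [h2] at this
        exact this
      · refine ⟨shpI_self hf _, ?_, Or.inl rfl⟩
        simp only [h1]
        exact shpI_self hg _
      · exact (shp_adj _ _).2 (Or.inr ⟨rfl, Or.inl (Nat.sub_add_cancel (by omega))⟩)
  refine ⟨fun v => {p | shpB f g v.1 v.2 p.1.1 p.1.2}, ?_, ?_, ?_, ?_⟩
  · rintro ⟨s, t⟩
    have hc : shpB f g s t (f s) (g t) := ⟨shpI_self hf _, shpI_self hg _, Or.inl rfl⟩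
    have a1 := hfN s s.2
    have a2 := hgN t t.2
    refine shp_conn _ ⟨⟨(⟨f s, a1⟩, ⟨g t, a2⟩), hJ s t _ hc⟩, hc⟩
      (fun p => ((p.1.1.1.val - f s) + (f s - p.1.1.1.val)) +
        ((p.1.1.2.val - g t) + (g t - p.1.1.2.val))) ?_
    rintro ⟨⟨⟨x, y⟩, hp⟩, hB⟩ hne
    have hB' : shpB f g s t x y := hB
    obtain ⟨hx, hy, hxy⟩ := hB'
    by_cases hxe : x.val = f s
    · have hye : y.val ≠ g t := by
        intro hye
        apply hne
        simp only [Subtype.mk.injEq, Prod.mk.injEq, Fin.ext_iff]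
        exact ⟨hxe, hye⟩
      obtain ⟨z, hz, hz1, hz2, hz3⟩ := shpI_step hg hy hye
      have hb : shpB f g s t x z := ⟨hx, hz, Or.inl hxe⟩
      have hzN : z < N := by have := y.2; omega
      refine ⟨⟨⟨(x, ⟨z, hzN⟩), hJ s t _ hb⟩, hb⟩, ?_, ?_⟩
      · exact (shp_adj _ _).2 (Or.inl ⟨rfl, hz1⟩)
      · simp only
        omega
    · have hye : y.val = g t := by tauto
      obtain ⟨z, hz, hz1, hz2, hz3⟩ := shpI_step hf hx hxe
      have hb : shpB f g s t z y := ⟨hz, hy, Or.inr hye⟩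
      have hzN : z < N := by have := x.2; omega
      refine ⟨⟨⟨(⟨z, hzN⟩, y), hJ s t _ hb⟩, hb⟩, ?_, ?_⟩
      · exact (shp_adj _ _).2 (Or.inr ⟨rfl, hz1⟩)
      · simp only
        omega
  · intro u v huv
    rw [Set.disjoint_left]
    rintro p ⟨h1, h2, -⟩ ⟨h3, h4, -⟩
    exact huv (Prod.ext (Fin.ext (shpI_disj hf h1 h3)) (Fin.ext (shpI_disj hg h2 h4)))
  · intro u v huv
    rw [shp_adj] at huv
    by_cases h : (u.1.val = v.1.val ∧ u.2.val + 1 = v.2.val) ∨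
        (u.2.val = v.2.val ∧ u.1.val + 1 = v.1.val)
    · obtain ⟨x, y, hx, hy, hxy⟩ := hE u v h
      exact ⟨⟨x, hJ _ _ _ hx⟩, hx, ⟨y, hJ _ _ _ hy⟩, hy, hxy⟩
    · obtain ⟨x, y, hx, hy, hxy⟩ := hE v u (by omega)
      exact ⟨⟨y, hJ _ _ _ hy⟩, hy, ⟨x, hJ _ _ _ hx⟩, hx, hxy.symm⟩
  · rintro ⟨s, t⟩ c hc
    obtain ⟨ht, x, hx1, hx2, hx3⟩ := hψ _ c hc
    simp only at ht hx1
    have hb : shpB f g s t x.1 x.2 := by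
      refine ⟨?_, ?_, Or.inl hx1⟩
      · rw [hx1]; exact shpI_self hf _
      · rw [hx2, ht]
        exact ⟨Or.inl rfl, Nat.lt_of_le_of_lt (Nat.zero_le _) (hg (Nat.lt_succ_self 0))⟩
    exact ⟨⟨x, hJ _ _ _ hb⟩, hb, hx3⟩

def shpF (k r i s : ℕ) : ℕ := (s / r) * (k * r) + (i * r + s % r)

lemma shpF_lt {k r i s : ℕ} (hr : 0 < r) (hi : i < k) : i * r + s % r < k * r := by
  have h1 := Nat.mod_lt s hr
  have h2 : (i + 1) * r ≤ k * r := Nat.mul_le_mul_right r hi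
  rw [Nat.add_mul] at h2
  omega

lemma shpF_bd {k r i s m : ℕ} (hr : 0 < r) (hi : i < k) (h : s / r < m) :
    shpF k r i s < m * (k * r) := by
  have h1 := shpF_lt (s := s) hr hi
  have h2 : (s / r + 1) * (k * r) ≤ m * (k * r) := Nat.mul_le_mul_right _ h
  rw [Nat.add_mul] at h2
  unfold shpF
  omega

lemma shpF_mono {k r i : ℕ} (hr : 0 < r) (hi : i < k) : StrictMono (shpF k r i) := by
  intro a b hab
  have h1 := Nat.div_add_mod a r
  have h2 := Nat.div_add_mod b r
  rcases (Nat.div_le_div_right (c := r) hab.le).lt_or_eq with h | h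
  · have := shpF_bd (s := a) hr hi h
    have h3 : shpF k r i b = (b / r) * (k * r) + (i * r + b % r) := rfl
    omega
  · unfold shpF
    rw [h] at h1 ⊢
    omega

lemma shpF_inj {k r i j s t : ℕ} (hr : 0 < r) (hi : i < k) (hj : j < k)
    (h : shpF k r i s = shpF k r j t) : i = j := by
  have e : ∀ i s, i < k → (shpF k r i s % (k * r)) / r = i := by
    intro i s hi
    unfold shpF
    rw [Nat.mul_comm (s / r), Nat.mul_add_mod, Nat.mod_eq_of_lt (shpF_lt hr hi)]
    rw [Nat.add_comm, Nat.add_mul_div_right _ _ hr, Nat.div_eq_of_lt (Nat.mod_lt s hr), Nat.zero_add]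
  rw [← e i s hi, h, e j t hj]

/-- The `(q, k·r)`-segregated grid realizing `π` contains a half-integral packing of
size `k` of the `(q, r)`-segregated grid realizing `π`: `k` subgraphs, each containing
it as a colorful minor, with every vertex used by at most two of them. -/
theorem segregated_half_integral_packing (q k r : ℕ) (hq : 0 < q) (hk : 0 < k)
    (hr : 0 < r) (π : Equiv.Perm (Fin q)) :
    ∃ J : Fin k → Set (Fin (q * (k * r)) × Fin (q * (k * r))),
      (∀ v, {i : Fin k | v ∈ J i}.ncard ≤ 2) ∧
      ∀ i, IsColorfulMinor (gridGraph (q * r)) (segPalette q r π)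
        ((gridGraph (q * (k * r))).induce (J i))
        (fun x => segPalette q (k * r) π x.1) := by
  refine ⟨fun i => {p | (∃ s < q * r, p.1.val = shpF k r i s) ∨
    ∃ t < q * r, p.2.val = i.val * (q * r) + t}, ?_, ?_⟩
  · intro v
    have hsub : {i : Fin k | v ∈ {p : Fin (q * (k * r)) × Fin (q * (k * r)) |
        (∃ s < q * r, p.1.val = shpF k r i s) ∨ ∃ t < q * r, p.2.val = i.val * (q * r) + t}} =
        {i : Fin k | ∃ s < q * r, v.1.val = shpF k r i s} ∪
        {i : Fin k | ∃ t < q * r, v.2.val = i.val * (q * r) + t} := rfl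
    have h1 : {i : Fin k | ∃ s < q * r, v.1.val = shpF k r i s}.ncard ≤ 1 := by
      rw [Set.ncard_le_one_iff]
      rintro a b ⟨s, -, hs⟩ ⟨t, -, ht⟩
      exact Fin.ext (shpF_inj hr a.2 b.2 (hs.symm.trans ht))
    have h2 : {i : Fin k | ∃ t < q * r, v.2.val = i.val * (q * r) + t}.ncard ≤ 1 := by
      rw [Set.ncard_le_one_iff]
      have e : ∀ i t, t < q * r → (i * (q * r) + t) / (q * r) = i := by
        intro i t ht
        rw [Nat.add_comm, Nat.add_mul_div_right _ _ (Nat.mul_pos hq hr), Nat.div_eq_of_lt ht,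
          Nat.zero_add]
      rintro a b ⟨s, hs', hs⟩ ⟨t, ht', ht⟩
      apply Fin.ext
      rw [← e a s hs', ← hs, ht, e b t ht']
    calc _ = _ := congrArg Set.ncard hsub
      _ ≤ _ := Set.ncard_union_le _ _
      _ ≤ 2 := by omega
  · intro i
    refine shp_minor (shpF k r i) (fun t => i.val * (q * r) + t) (shpF_mono hr i.2)
      (fun a b h => Nat.add_lt_add_left h _) ?_ ?_ (segPalette q r π) (segPalette q (k * r) π) ?_
    · intro s hs
      exact shpF_bd hr i.2 (Nat.div_lt_of_lt_mul (by rwa [Nat.mul_comm]))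
    · intro t ht
      have h2 : (i.val + 1) * (q * r) ≤ k * (q * r) := Nat.mul_le_mul_right _ i.2
      rw [Nat.add_mul] at h2
      have h3 : k * (q * r) = q * (k * r) := by ring
      omega
    · rintro ⟨s, t⟩ c hc
      simp only [segPalette, Finset.mem_filter, Finset.mem_univ, true_and] at hc
      obtain ⟨h0, h1, h2⟩ := hc
      have hd : s.val / r = (π.symm c).val := by
        apply Nat.div_eq_of_lt_le h1 h2
      have hlt := shpF_bd (s := s.val) hr i.2 (Nat.lt_succ_self (s.val / r))
      have hlt2 := shpF_bd (s := s.val) (m := q) hr i.2 (by rw [hd]; exact (π.symm c).2)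
      refine ⟨h0, (⟨shpF k r i s, hlt2⟩, ⟨0, by omega⟩), rfl, rfl, ?_⟩
      simp only [segPalette, Finset.mem_filter, Finset.mem_univ, true_and]
      rw [← hd]
      exact ⟨Nat.le_add_right _ _, hlt⟩
end

section
/- Let d be a positive integer, (G,χ) a q-colorful graph, Z ⊆ V(G), and let (A,B) be a separation of G with Z ⊆ A. If v ∈ B∖A and the d-folio of (G[B],χ) relative to A∩B equals the d-folio of (G[B]−v,χ) relative to A∩B, then the d-folio of (G,χ) relative to Z equals the d-folio of (G−v,χ) relative to Z. -/
open SimpleGraph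

/-- A separation of `G`. -/
def IsSeparation {V : Type*} (G : SimpleGraph V) (A B : Set V) : Prop :=
  A ∪ B = Set.univ ∧ ∀ a ∈ A \ B, ∀ b ∈ B \ A, ¬ G.Adj a b

/-- The rooted `q`-colorful graph `(H, ψ, u₁, …, u_K)` is a rooted colorful minor of
`(G, χ, z₁, …, z_K)` with all branch sets inside `W` (so this is a rooted colorful
minor of the subgraph of `G` induced on `W`). -/
def RootedMinorIn {q K : ℕ} {V α : Type*} (G : SimpleGraph V) (χ : V → Finset (Fin q))
    (W : Set V) (z : Fin K → V)
    (H : SimpleGraph α) (ψ : α → Finset (Fin q)) (u : Fin K → α) : Prop :=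
  ∃ X : α → Set V,
    (∀ a, X a ⊆ W) ∧
    (∀ a, (G.induce (X a)).Connected) ∧
    (Pairwise fun a b => Disjoint (X a) (X b)) ∧
    (∀ a b, H.Adj a b → ∃ x ∈ X a, ∃ y ∈ X b, G.Adj x y) ∧
    (∀ a, ∀ c ∈ ψ a, ∃ x ∈ X a, c ∈ χ x) ∧
    (∀ i, z i ∈ X (u i))

lemma glue_reach {V : Type*} (G : SimpleGraph V) (X : Set V) (T : V → Set V)
    (hT : ∀ x ∈ X, (G.induce (T x)).Connected)
    (hadj : ∀ x ∈ X, ∀ y ∈ X, G.Adj x y → T x = T y ∨ ∃ p ∈ T x, ∃ q ∈ T y, G.Adj p q)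
    (U : Set V) (hU : ∀ x ∈ X, T x ⊆ U) (x y : X) (W : (G.induce X).Walk x y) :
    ∀ p (hp : p ∈ T x) q (hq : q ∈ T y),
      (G.induce U).Reachable ⟨p, hU x x.2 hp⟩ ⟨q, hU y y.2 hq⟩ := by
  have key : ∀ (x : X) p (hp : p ∈ T x) q (hq : q ∈ T x),
      (G.induce U).Reachable ⟨p, hU x x.2 hp⟩ ⟨q, hU x x.2 hq⟩ := by
    intro x p hp q hq
    have h := (hT x x.2).preconnected ⟨p, hp⟩ ⟨q, hq⟩
    exact h.map (G.induceHomOfLE (hU x x.2)).toHom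
  induction W with
  | nil => exact key _
  | @cons a b c h W ih =>
    intro p hp q hq
    rcases hadj a a.2 b b.2 h with e | ⟨r, hr, s, hs, hrs⟩
    · exact ih p (e ▸ hp) q hq
    · refine (key a p hp r hr).trans (Reachable.trans ?_ (ih s hs q hq))
      exact Adj.reachable (G := G.induce U) (u := ⟨r, _⟩) (v := ⟨s, _⟩) hrs

lemma glue_connected {V : Type*} (G : SimpleGraph V) (X : Set V) (T : V → Set V)
    (hX : (G.induce X).Connected)
    (hT : ∀ x ∈ X, (G.induce (T x)).Connected)
    (hadj : ∀ x ∈ X, ∀ y ∈ X, G.Adj x y → T x = T y ∨ ∃ p ∈ T x, ∃ q ∈ T y, G.Adj p q) :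
    (G.induce {p | ∃ x ∈ X, p ∈ T x}).Connected := by
  obtain ⟨x⟩ := hX.nonempty
  obtain ⟨p⟩ := (hT x x.2).nonempty
  have : Nonempty ↥{p | ∃ x ∈ X, p ∈ T x} := ⟨⟨p, x, x.2, p.2⟩⟩
  refine ⟨?_⟩
  rintro ⟨p, x, hx, hp⟩ ⟨q, y, hy, hq⟩
  obtain ⟨W⟩ := hX.preconnected ⟨x, hx⟩ ⟨y, hy⟩
  exact glue_reach G X T hT hadj {p | ∃ x ∈ X, p ∈ T x}
    (fun x hx p hp => ⟨x, hx, hp⟩) _ _ W p hp q hq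

lemma supp_connected {V : Type*} (G G' : SimpleGraph V) (h : G' ≤ G) (C : G'.ConnectedComponent) :
    (G.induce C.supp).Connected := by
  have h1 : (G'.induce C.supp).Connected := C.connected_toSimpleGraph
  exact h1.mono (fun a b hab => h hab)

lemma minor_transport {q L n : ℕ} (G : SimpleGraph (Fin n)) (χ : Fin n → Finset (Fin q))
    (W : Set (Fin n)) (w : Fin L → Fin n) {α β : Type*} (e : α ≃ β)
    (H : SimpleGraph α) (ψ : α → Finset (Fin q)) (u : Fin L → α) :
    RootedMinorIn G χ W w H ψ u ↔
      RootedMinorIn G χ W w (H.comap e.symm) (ψ ∘ e.symm) (e ∘ u) := by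
  constructor
  · rintro ⟨X, h1, h2, h3, h4, h5, h6⟩
    refine ⟨X ∘ e.symm, fun a => h1 _, fun a => h2 _, fun a b hab => h3 (by simpa using hab),
      fun a b hab => h4 _ _ hab, fun a => h5 _, fun i => by simpa using h6 i⟩
  · rintro ⟨X, h1, h2, h3, h4, h5, h6⟩
    refine ⟨X ∘ e, fun a => h1 _, fun a => h2 _, fun a b hab => h3 (by simpa using hab),
      fun a b hab => h4 _ _ (by simpa using hab), fun a => by simpa using h5 (e a), fun i => h6 i⟩

lemma folio_transport {q d L n : ℕ} (G : SimpleGraph (Fin n)) (χ : Fin n → Finset (Fin q))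
    (B B' : Set (Fin n)) (w : Fin L → Fin n)
    (hfolio : ∀ (m : ℕ) (H : SimpleGraph (Fin m)) (ψ : Fin m → Finset (Fin q))
        (u : Fin L → Fin m),
      H.edgeSet.ncard ≤ d → {a : Fin m | a ∉ Set.range u}.ncard ≤ d →
      (RootedMinorIn G χ B w H ψ u ↔ RootedMinorIn G χ B' w H ψ u))
    {α : Type*} [Finite α] (H : SimpleGraph α) (ψ : α → Finset (Fin q)) (u : Fin L → α)
    (h1 : H.edgeSet.ncard ≤ d) (h2 : {a : α | a ∉ Set.range u}.ncard ≤ d)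
    (h : RootedMinorIn G χ B w H ψ u) : RootedMinorIn G χ B' w H ψ u := by
  obtain ⟨m, ⟨e⟩⟩ := Finite.exists_equiv_fin α
  rw [minor_transport G χ _ w e] at h ⊢
  refine (hfolio _ _ _ _ ?_ ?_).1 h
  · refine le_trans ?_ h1
    have := (Iso.comap e.symm H).mapEdgeSet
    rw [← Nat.card_coe_set_eq, ← Nat.card_coe_set_eq, Nat.card_congr this]
  · refine le_trans (Set.ncard_le_ncard_of_injOn e.symm ?_ e.symm.injective.injOn) h2
    rintro a ha ⟨i, hi⟩
    exact ha ⟨i, by simp [hi]⟩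

/-- If `(A, B)` is a separation with `Z ⊆ A` and `v ∈ B ∖ A` such that the `d`-folio of
`(G[B], χ)` relative to `A ∩ B` equals the `d`-folio of `(G[B] − v, χ)` relative to
`A ∩ B`, then the `d`-folio of `(G, χ)` relative to `Z` equals the `d`-folio of
`(G − v, χ)` relative to `Z`.  Equality of folios is expressed by agreement on every
rooted `q`-colorful graph of detail at most `d`. -/
theorem separation_irrelevancy (q d K L : ℕ) (hd : 0 < d)
    {n : ℕ} (G : SimpleGraph (Fin n)) (χ : Fin n → Finset (Fin q))
    (z : Fin K → Fin n) (hz : Function.Injective z)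
    (A B : Set (Fin n)) (hsep : IsSeparation G A B)
    (hZ : Set.range z ⊆ A)
    (w : Fin L → Fin n) (hw : Function.Injective w) (hwrange : Set.range w = A ∩ B)
    (v : Fin n) (hv : v ∈ B \ A)
    (hfolio : ∀ (m : ℕ) (H : SimpleGraph (Fin m)) (ψ : Fin m → Finset (Fin q))
        (u : Fin L → Fin m),
      H.edgeSet.ncard ≤ d → {a : Fin m | a ∉ Set.range u}.ncard ≤ d →
      (RootedMinorIn G χ B w H ψ u ↔ RootedMinorIn G χ (B \ {v}) w H ψ u)) :
    ∀ (m : ℕ) (H : SimpleGraph (Fin m)) (ψ : Fin m → Finset (Fin q))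
        (u : Fin K → Fin m),
      H.edgeSet.ncard ≤ d → {a : Fin m | a ∉ Set.range u}.ncard ≤ d →
      (RootedMinorIn G χ Set.univ z H ψ u ↔ RootedMinorIn G χ {v}ᶜ z H ψ u) := by
  classical
  intro m H ψ u hE hR
  constructor
  swap
  · rintro ⟨X, h1, h⟩
    exact ⟨X, fun a => Set.subset_univ _, h⟩
  rintro ⟨X, -, hconn, hdisj, hedge, hcol, hroot⟩
  obtain ⟨hAB, hno⟩ := hsep
  have hXeq : ∀ {x a b}, x ∈ X a → x ∈ X b → a = b := by
    intro x a b ha hb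
    by_contra hne
    exact Set.disjoint_left.1 (hdisj hne) ha hb
  have hA : ∀ x, x ∉ B → x ∈ A := by
    intro x hx
    have : x ∈ A ∪ B := hAB ▸ Set.mem_univ x
    exact this.resolve_right hx
  have hadjA : ∀ x y, x ∉ B → G.Adj x y → y ∈ A := by
    intro x y hx hxy
    by_contra hy
    have hyB : y ∈ B := by
      by_contra h
      exact hy (hA y h)
    exact hno x ⟨hA x hx, hx⟩ y ⟨hyB, hy⟩ hxy
  -- the auxiliary graph
  let G' : SimpleGraph (Fin n) :=
    { Adj := fun x y => G.Adj x y ∧ x ∈ B ∧ y ∈ B ∧ ∃ a, x ∈ X a ∧ y ∈ X a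
      symm := ⟨fun x y ⟨h1, h2, h3, a, h4, h5⟩ => ⟨h1.symm, h3, h2, a, h5, h4⟩⟩
      loopless := ⟨fun x h => G.loopless.irrefl x h.1⟩ }
  have hG' : G' ≤ G := fun x y h => h.1
  have hreachB : ∀ x y, G'.Reachable x y → x ∈ B → y ∈ B := by
    rintro x y ⟨W⟩
    induction W with
    | nil => exact id
    | cons h W ih => exact fun _ => ih h.2.2.1
  have hreachX : ∀ x y, G'.Reachable x y → ∀ a, x ∈ X a → y ∈ X a := by
    rintro x y ⟨W⟩
    induction W with
    | nil => exact fun a => id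
    | cons h W ih =>
      intro a ha
      obtain ⟨-, -, -, b, hb, hb'⟩ := h
      exact ih a (hXeq ha hb ▸ hb')
  let mk := G'.connectedComponentMk
  have hmk : ∀ {x y}, mk x = mk y → G'.Reachable x y := fun h => ConnectedComponent.exact h
  let α := {C : G'.ConnectedComponent // ∃ x ∈ B, (x ∈ A ∨ ∃ a, x ∈ X a) ∧ mk x = C}
  have hwAB : ∀ i, w i ∈ A ∩ B := fun i => hwrange ▸ Set.mem_range_self i
  let u' : Fin L → α := fun i => ⟨mk (w i), w i, (hwAB i).2, Or.inl (hwAB i).1, rfl⟩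
  have hF : ∀ e : Sym2 (Fin m), ∃ f : Sym2 G'.ConnectedComponent, e ∈ H.edgeSet →
      ∃ a b x y, e = s(a, b) ∧ x ∈ X a ∧ y ∈ X b ∧ G.Adj x y ∧ f = s(mk x, mk y) := by
    intro e
    by_cases he : e ∈ H.edgeSet
    · induction e with
      | _ a b =>
        obtain ⟨x, hx, y, hy, hxy⟩ := hedge a b he
        exact ⟨_, fun _ => ⟨a, b, x, y, rfl, hx, hy, hxy, rfl⟩⟩
    · exact ⟨s(mk v, mk v), fun h => absurd h he⟩
  choose F hF using hF
  let H' : SimpleGraph α := (fromEdgeSet (F '' H.edgeSet)).comap Subtype.val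
  let ψ' : α → Finset (Fin q) := fun C => Finset.univ.filter fun c => ∃ x ∈ C.1.supp, c ∈ χ x
  have hE' : H'.edgeSet.ncard ≤ d := by
    refine le_trans ?_ ((Set.ncard_image_le (f := F) (Set.toFinite H.edgeSet)).trans hE)
    refine Set.ncard_le_ncard_of_injOn (Sym2.map Subtype.val) ?_
      (Sym2.map.injective Subtype.val_injective).injOn (Set.toFinite _)
    intro e he
    induction e with
    | _ C D =>
      have : (fromEdgeSet (F '' H.edgeSet)).Adj C.1 D.1 := he
      rw [fromEdgeSet_adj] at this
      simpa using this.1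
  have hR' : {C : α | C ∉ Set.range u'}.ncard ≤ d := by
    refine le_trans ?_ hR
    have hex : ∀ C : {C : α | C ∉ Set.range u'}, ∃ a : {a | a ∉ Set.range u},
        X a.1 ⊆ C.1.1.supp := by
      rintro ⟨⟨C, x, hxB, hx, rfl⟩, hC⟩
      have hCA : ∀ y, G'.Reachable x y → y ∉ A := by
        intro y hy hyA
        have : y ∈ Set.range w := hwrange ▸ ⟨hyA, hreachB _ _ hy hxB⟩
        obtain ⟨i, rfl⟩ := this
        exact hC ⟨i, Subtype.ext (ConnectedComponent.sound hy.symm)⟩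
      obtain ⟨a, ha⟩ := hx.resolve_left (hCA x (Reachable.refl x))
      have hsub : ∀ s t : X a, (G.induce (X a)).Walk s t → G'.Reachable x s →
          G'.Reachable x t := by
        intro s t W
        induction W with
        | nil => exact id
        | @cons s t r h W ih =>
          intro hs
          apply ih
          have hst : G.Adj s t := h
          have htB : t.1 ∈ B := by
            by_contra htB
            exact hCA _ hs (hadjA _ _ htB hst.symm)
          have : G'.Adj s t := ⟨hst, hreachB _ _ hs hxB, htB, a, s.2, t.2⟩
          exact hs.trans this.reachable
      have hsub' : ∀ y ∈ X a, G'.Reachable x y := by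
        intro y hy
        obtain ⟨W⟩ := (hconn a).preconnected ⟨x, ha⟩ ⟨y, hy⟩
        exact hsub _ _ W (Reachable.refl x)
      refine ⟨⟨a, ?_⟩, fun y hy => ConnectedComponent.sound (hsub' y hy).symm⟩
      rintro ⟨i, rfl⟩
      exact hCA _ (hsub' _ (hroot i)) (hZ ⟨i, rfl⟩)
    choose g hg using hex
    rw [← Nat.card_coe_set_eq, ← Nat.card_coe_set_eq]
    refine Nat.card_le_card_of_injective g ?_
    intro C D hCD
    obtain ⟨x⟩ := (hconn (g C).1).nonempty
    have h1 : mk x.1 = C.1.1 := hg C x.2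
    have h2 : mk x.1 = D.1.1 := hg D (hCD ▸ x.2)
    exact Subtype.ext (Subtype.ext (h1.symm.trans h2))
  have hmodel : RootedMinorIn G χ B w H' ψ' u' := by
    refine ⟨fun C => C.1.supp, ?_, fun C => supp_connected G G' hG' C.1, ?_, ?_, ?_, ?_⟩
    · rintro ⟨C, x, hxB, hx, rfl⟩ y hy
      exact hreachB x y (hmk (Eq.symm hy)) hxB
    · intro C D hCD
      refine Set.disjoint_left.2 fun x hx hx' => hCD (Subtype.ext ?_)
      exact (Eq.symm hx).trans hx'
    · intro C D hCD
      have : (fromEdgeSet (F '' H.edgeSet)).Adj C.1 D.1 := hCD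
      rw [fromEdgeSet_adj] at this
      obtain ⟨⟨e, he, hFe⟩, -⟩ := this
      obtain ⟨a, b, x, y, -, hx, hy, hxy, hf⟩ := hF e he
      rw [hFe, Sym2.eq_iff] at hf
      rcases hf with ⟨h1, h2⟩ | ⟨h1, h2⟩
      · exact ⟨x, h1.symm, y, h2.symm, hxy⟩
      · exact ⟨y, h1.symm, x, h2.symm, hxy.symm⟩
    · intro C c hc
      simpa [ψ'] using hc
    · intro i
      rfl
  obtain ⟨Y, hYB, hYconn, hYdisj, hYedge, hYcol, hYroot⟩ :=
    folio_transport G χ B (B \ {v}) w hfolio H' ψ' u' hE' hR' hmodel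
  let T : Fin n → Set (Fin n) := fun x =>
    {p | (x ∉ B ∧ p = x) ∨ ∃ C : α, x ∈ B ∧ C.1 = mk x ∧ p ∈ Y C}
  have hTn : ∀ x, x ∉ B → T x = {x} := by
    intro x hx
    ext p
    simp [T, hx]
  have hTB : ∀ x (hx : x ∈ B) (C : α), C.1 = mk x → T x = Y C := by
    intro x hx C hC
    ext p
    constructor
    · rintro (⟨h, -⟩ | ⟨D, -, hD, hp⟩)
      · exact absurd hx h
      · have : D = C := Subtype.ext (hD.trans hC.symm)
        exact this ▸ hp
    · exact fun hp => Or.inr ⟨C, hx, hC, hp⟩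
  have hTA : ∀ x, x ∈ A → x ∈ T x := by
    intro x hx
    by_cases hxB : x ∈ B
    · have : x ∈ Set.range w := hwrange ▸ ⟨hx, hxB⟩
      obtain ⟨i, rfl⟩ := this
      rw [hTB _ hxB (u' i) rfl]
      exact hYroot i
    · rw [hTn x hxB]
      rfl
  have hcomp : ∀ {x a}, x ∈ B → x ∈ X a → ∃ C : α, C.1 = mk x := 
    fun {x a} hB ha => ⟨⟨mk x, x, hB, Or.inr ⟨a, ha⟩, rfl⟩, rfl⟩
  refine ⟨fun a => {p | ∃ x ∈ X a, p ∈ T x}, ?_, ?_, ?_, ?_, ?_, ?_⟩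
  · rintro a p ⟨x, hx, ⟨hxB, rfl⟩ | ⟨C, hxB, hC, hp⟩⟩
    · rintro rfl
      exact hxB hv.1
    · exact (hYB C hp).2
  · intro a
    refine glue_connected G (X a) T (hconn a) ?_ ?_
    · intro x hx
      by_cases hxB : x ∈ B
      · obtain ⟨C, hC⟩ := hcomp hxB hx
        rw [hTB x hxB C hC]
        exact hYconn C
      · rw [hTn x hxB]
        exact Connected.of_subsingleton
    · intro x hx y hy hxy
      by_cases hxB : x ∈ B
      · by_cases hyB : y ∈ B
        · left
          obtain ⟨C, hC⟩ := hcomp hxB hx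
          have : G'.Adj x y := ⟨hxy, hxB, hyB, a, hx, hy⟩
          have h2 : mk x = mk y := ConnectedComponent.sound this.reachable
          rw [hTB x hxB C hC, hTB y hyB C (hC.trans h2)]
        · exact Or.inr ⟨x, hTA x (hadjA y x hyB hxy.symm), y, hTA y (hA y hyB), hxy⟩
      · exact Or.inr ⟨x, hTA x (hA x hxB), y, hTA y (hadjA x y hxB hxy), hxy⟩
  · intro a b hab
    refine Set.disjoint_left.2 ?_
    rintro p ⟨x, hx, ⟨hxB, rfl⟩ | ⟨C, hxB, hC, hp⟩⟩ ⟨y, hy, ⟨hyB, hpy⟩ | ⟨D, hyB, hD, hp'⟩⟩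
    · exact hab (hXeq hx (hpy ▸ hy))
    · exact hxB (hYB D hp').1
    · exact hyB (hpy ▸ (hYB C hp).1)
    · have hCD : C = D := by
        by_contra h
        exact Set.disjoint_left.1 (hYdisj h) hp hp'
      subst hCD
      exact hab (hXeq (hreachX x y (hmk (hC.symm.trans hD)) a hx) hy)
  · intro a b hab
    obtain ⟨a', b', x, y, he, hx, hy, hxy, hf⟩ := hF s(a, b) hab
    have main : ∃ p, (∃ x ∈ X a', p ∈ T x) ∧ ∃ q, (∃ y ∈ X b', q ∈ T y) ∧ G.Adj p q := by
      by_cases hxB : x ∈ B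
      · by_cases hyB : y ∈ B
        · obtain ⟨C, hC⟩ := hcomp hxB hx
          obtain ⟨D, hD⟩ := hcomp hyB hy
          have hne : a' ≠ b' := by
            rintro rfl
            have : a = b := by
              rcases Sym2.eq_iff.1 he with ⟨h1, h2⟩ | ⟨h1, h2⟩ <;> exact h1.trans h2.symm
            exact hab.ne this
          have hCD : H'.Adj C D := by
            change (fromEdgeSet (F '' H.edgeSet)).Adj C.1 D.1
            rw [fromEdgeSet_adj]
            refine ⟨⟨s(a, b), hab, by rw [hf, hC, hD]⟩, ?_⟩
            intro h
            rw [hC, hD] at h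
            exact hne (hXeq (hreachX x y (hmk h) a' hx) hy)
          obtain ⟨p, hp, q, hq, hpq⟩ := hYedge C D hCD
          exact ⟨p, ⟨x, hx, (hTB x hxB C hC).symm ▸ hp⟩, q,
            ⟨y, hy, (hTB y hyB D hD).symm ▸ hq⟩, hpq⟩
        · exact ⟨x, ⟨x, hx, hTA x (hadjA y x hyB hxy.symm)⟩, y, ⟨y, hy, hTA y (hA y hyB)⟩, hxy⟩
      · exact ⟨x, ⟨x, hx, hTA x (hA x hxB)⟩, y, ⟨y, hy, hTA y (hadjA x y hxB hxy)⟩, hxy⟩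
    obtain ⟨p, hp, q, hq, hpq⟩ := main
    rcases Sym2.eq_iff.1 he with ⟨rfl, rfl⟩ | ⟨rfl, rfl⟩
    · exact ⟨p, hp, q, hq, hpq⟩
    · exact ⟨q, hq, p, hp, hpq.symm⟩
  · intro a c hc
    obtain ⟨x, hx, hcx⟩ := hcol a c hc
    by_cases hxB : x ∈ B
    · obtain ⟨C, hC⟩ := hcomp hxB hx
      have : c ∈ ψ' C := by
        simp only [ψ', Finset.mem_filter, Finset.mem_univ, true_and]
        exact ⟨x, hC.symm, hcx⟩
      obtain ⟨p, hp, hcp⟩ := hYcol C c this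
      exact ⟨p, ⟨x, hx, (hTB x hxB C hC).symm ▸ hp⟩, hcp⟩
    · exact ⟨x, ⟨x, hx, hTA x (hA x hxB)⟩, hcx⟩
  · intro i
    exact ⟨z i, hroot i, hTA _ (hZ ⟨i, rfl⟩)⟩
end

section
/- Let d, k, and p be positive integers with p ≥ ⌊(5/2)·k⌋ + 3d. Let (G,χ) be a q-colorful graph and Z ⊆ V(G) with |Z| = k. If there exists a colorful minor model X of the rainbow K_p in (G,χ) such that there is no separation (A,B) of G of order less than k with Z ⊆ A and some branch set of X contained in B∖A, then the d-folio of (G,χ) relative to Z is generic, i.e., it contains every rooted q-colorful graph with k roots of detail at most d. -/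
open SimpleGraph

namespace GF

lemma conn_iff {V : Type*} (G : SimpleGraph V) (s : Set V) :
    (G.induce s).Connected ↔ s.Nonempty ∧ ∀ T : Set V, (∃ a ∈ s, a ∈ T) →
      (∀ a ∈ s, a ∈ T → ∀ b ∈ s, G.Adj a b → b ∈ T) → s ⊆ T := by
  constructor
  · intro h
    refine ⟨Set.nonempty_coe_sort.1 h.nonempty, ?_⟩
    rintro T ⟨a, has, haT⟩ hcl b hb
    obtain ⟨p⟩ := h.preconnected ⟨a, has⟩ ⟨b, hb⟩
    have : ∀ (u v : s) (p : (G.induce s).Walk u v), u.1 ∈ T → v.1 ∈ T := by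
      intro u v p
      induction p with
      | nil => exact id
      | cons hadj _ ih => exact fun hu => ih (hcl _ (Subtype.property _) hu _ (Subtype.property _) hadj)
    exact this _ _ p haT
  · rintro ⟨⟨a, ha⟩, h⟩
    rw [connected_iff_exists_forall_reachable]
    refine ⟨⟨a, ha⟩, ?_⟩
    rintro ⟨b, hb⟩
    have := h {v | ∃ hv : v ∈ s, (G.induce s).Reachable ⟨a, ha⟩ ⟨v, hv⟩}
      ⟨a, ha, ha, Reachable.refl _⟩ ?_ hb
    · exact this.2
    · rintro u hu ⟨_, hr⟩ v hv hadj
      refine ⟨hv, hr.trans (Adj.reachable ?_)⟩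
      exact hadj

lemma conn_singleton {V : Type*} (G : SimpleGraph V) (v : V) : (G.induce {v}).Connected := by
  rw [conn_iff]
  refine ⟨⟨v, rfl⟩, ?_⟩
  rintro T ⟨a, rfl, ha⟩ _ b rfl
  exact ha

lemma conn_mono {V : Type*} {G G' : SimpleGraph V} (h : G ≤ G') {s : Set V}
    (hs : (G.induce s).Connected) : (G'.induce s).Connected := by
  rw [conn_iff] at hs ⊢
  exact ⟨hs.1, fun T hT hcl => hs.2 T hT fun a ha haT b hb hab => hcl a ha haT b hb (h hab)⟩

lemma sep_symm {V : Type*} {G : SimpleGraph V} {A B : Set V} (h : IsSeparation G A B) :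
    IsSeparation G B A := by
  refine ⟨by rw [Set.union_comm]; exact h.1, fun a ha b hb hab => h.2 b hb a ha hab.symm⟩

/-- one half of the splitting step in Menger's theorem -/
lemma menger_half {V : Type*} [Finite V] {G : SimpleGraph V} {Z W A B : Set V} {k : ℕ} {x y : V}
    (hG : ∀ A B, IsSeparation G A B → Z ⊆ A → W ⊆ B → k ≤ (A ∩ B).ncard)
    (hcov : A ∪ B = Set.univ)
    (hsep : ∀ a ∈ A \ B, ∀ b ∈ B \ A, G.Adj a b → a = x ∧ b = y)
    (hx : x ∈ A \ B) (hy : y ∈ B \ A)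
    (hZ : Z ⊆ A) (hW : W ⊆ B) (hS : (A ∩ B).ncard < k)
    (IH : ∀ G' : SimpleGraph V, G' < G → ∀ Z W : Set V,
      (∀ A B, IsSeparation G' A B → Z ⊆ A → W ⊆ B → k ≤ (A ∩ B).ncard) →
      ∃ Y : Fin k → Set V, (∀ i, (G'.induce (Y i)).Connected) ∧
        (Pairwise fun i j => Disjoint (Y i) (Y j)) ∧ (∀ i, (Y i ∩ Z).Nonempty) ∧
        (∀ i, (Y i ∩ W).Nonempty))
    (hadj : G.Adj x y) :
    ∃ (Y : Fin k → Set V) (g : Fin k → V), (∀ i, (G.induce (Y i)).Connected) ∧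
        (Pairwise fun i j => Disjoint (Y i) (Y j)) ∧ (∀ i, (Y i ∩ Z).Nonempty) ∧
        (∀ i, Y i ⊆ A) ∧ (∀ i, g i ∈ Y i) ∧ Set.range g = insert x (A ∩ B) := by
  classical
  let G' : SimpleGraph V :=
    { Adj := fun a b => G.Adj a b ∧ a ∈ A ∧ b ∈ A
      symm := ⟨fun a b h => ⟨h.1.symm, h.2.2, h.2.1⟩⟩
      loopless := ⟨fun a h => G.loopless.irrefl a h.1⟩ }
  have hle : G' ≤ G := fun a b h => h.1
  have hlt : G' < G := by
    refine lt_of_le_not_ge hle fun h => ?_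
    exact hy.2 (h hadj).2.2
  obtain ⟨Y, hc, hd, hYZ, hYW⟩ := IH G' hlt Z (insert x (A ∩ B)) (by
    intro C D hCD hZC hD
    have := hG (C ∩ A) ((D ∩ A) ∪ B) ?_ (Set.subset_inter hZC hZ)
      (hW.trans Set.subset_union_right)
    · refine this.trans (Set.ncard_le_ncard ?_ (Set.toFinite _))
      rintro v ⟨⟨hvC, hvA⟩, ⟨hvD, _⟩ | hvB⟩
      · exact ⟨hvC, hvD⟩
      · exact ⟨hvC, hD (Or.inr ⟨hvA, hvB⟩)⟩
    · constructor
      · ext v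
        have h1 : v ∈ C ∪ D := by rw [hCD.1]; trivial
        have h2 : v ∈ A ∪ B := by rw [hcov]; trivial
        simp only [Set.mem_union, Set.mem_inter_iff, Set.mem_univ, iff_true] at *
        tauto
      · rintro a ⟨⟨haC, haA⟩, ha⟩ b ⟨hb, hb'⟩ hab
        have haD : a ∉ D := fun h => ha (Or.inl ⟨h, haA⟩)
        have haB : a ∉ B := fun h => ha (Or.inr h)
        by_cases hbA : b ∈ A
        · have hbC : b ∉ C := fun h => hb' ⟨h, hbA⟩
          have hbD : b ∈ D := by
            have : b ∈ C ∪ D := by rw [hCD.1]; trivial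
            exact this.resolve_left hbC
          exact hCD.2 a ⟨haC, haD⟩ b ⟨hbD, hbC⟩ ⟨hab, haA, hbA⟩
        · have hbB : b ∈ B := by
            rcases hb with h | h
            · exact absurd h.2 hbA
            · exact h
          have := hsep a ⟨haA, haB⟩ b ⟨hbB, hbA⟩ hab
          exact haD (hD (Or.inl this.1)))
  choose g hg using hYW
  have hginj : Function.Injective g := by
    intro i j hij
    by_contra hne
    exact Set.disjoint_left.1 (hd hne) (hg i).1 (hij ▸ (hg j).1)
  have hYA : ∀ i, Y i ⊆ A := by
    intro i
    obtain ⟨v, hv, hvZ⟩ := hYZ i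
    exact ((conn_iff _ _).1 (hc i)).2 A ⟨v, hv, hZ hvZ⟩ (fun a _ _ b _ hab => hab.2.2)
  refine ⟨Y, g, fun i => conn_mono hle (hc i), hd, hYZ, hYA, fun i => (hg i).1, ?_⟩
  apply Set.eq_of_subset_of_ncard_le
  · rintro _ ⟨i, rfl⟩; exact (hg i).2
  · rw [← Set.image_univ, Set.ncard_image_of_injective _ hginj, Set.ncard_univ, Nat.card_fin]
    exact (Set.ncard_insert_le _ _).trans hS
  · exact Set.toFinite _

theorem menger {V : Type*} [Finite V] (k : ℕ) (G : SimpleGraph V) : ∀ Z W : Set V,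
    (∀ A B, IsSeparation G A B → Z ⊆ A → W ⊆ B → k ≤ (A ∩ B).ncard) →
    ∃ Y : Fin k → Set V, (∀ i, (G.induce (Y i)).Connected) ∧
      (Pairwise fun i j => Disjoint (Y i) (Y j)) ∧ (∀ i, (Y i ∩ Z).Nonempty) ∧
      (∀ i, (Y i ∩ W).Nonempty) := by
  classical
  induction G using WellFoundedLT.induction with
  | ind G IH =>
  intro Z W hG
  by_cases hbot : ∃ x y, G.Adj x y
  · obtain ⟨x, y, hxy⟩ := hbot
    let G' := G.deleteEdges {s(x, y)}
    have hle : G' ≤ G := deleteEdges_le _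
    have hlt : G' < G := by
      refine lt_of_le_not_ge hle fun h => ?_
      have := h hxy
      simp [G'] at this
    by_cases hG' : ∀ A B, IsSeparation G' A B → Z ⊆ A → W ⊆ B → k ≤ (A ∩ B).ncard
    · obtain ⟨Y, h1, h2⟩ := IH G' hlt Z W hG'
      exact ⟨Y, fun i => conn_mono hle (h1 i), h2⟩
    · push Not at hG'
      obtain ⟨A, B, hAB, hZ, hW, hS⟩ := hG'
      -- find the orientation
      have key : ∃ x y, G.Adj x y ∧ x ∈ A \ B ∧ y ∈ B \ A ∧
          ∀ a ∈ A \ B, ∀ b ∈ B \ A, G.Adj a b → a = x ∧ b = y := by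
        have hns : ¬ IsSeparation G A B := fun h => absurd (hG A B h hZ hW) (by omega)
        have : ∃ a ∈ A \ B, ∃ b ∈ B \ A, G.Adj a b := by
          by_contra hcon
          push Not at hcon
          exact hns ⟨hAB.1, hcon⟩
        obtain ⟨a, ha, b, hb, hab⟩ := this
        have hs : ∀ a ∈ A \ B, ∀ b ∈ B \ A, G.Adj a b → s(a, b) = s(x, y) := by
          intro a ha b hb hab
          by_contra hne
          exact hAB.2 a ha b hb (by simpa [G', deleteEdges_adj] using ⟨hab, by simpa using hne⟩)
        refine ⟨a, b, hab, ha, hb, ?_⟩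
        intro a' ha' b' hb' hab'
        have h := (hs a' ha' b' hb' hab').trans (hs a ha b hb hab).symm
        rw [Sym2.eq_iff] at h
        rcases h with h | h
        · exact h
        · exact absurd ha.1 (h.2 ▸ hb'.2)
      obtain ⟨u, v, huv, hu, hv, hsep⟩ := key
      have hcov : A ∪ B = Set.univ := hAB.1
      obtain ⟨Y, g, hY1, hY2, hY3, hY4, hY5, hY6⟩ :=
        menger_half hG hcov hsep hu hv hZ hW hS IH huv
      obtain ⟨T, h, hT1, hT2, hT3, hT4, hT5, hT6⟩ :=
        menger_half (G := G) (Z := W) (W := Z) (A := B) (B := A) (k := k) (x := v) (y := u)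
          (fun C D hCD h1 h2 => by
            rw [Set.inter_comm]; exact hG D C (sep_symm hCD) h2 h1)
          (by rw [Set.union_comm]; exact hcov)
          (fun a ha b hb hab => (hsep b hb a ha hab.symm).symm)
          hv hu hW hZ (by rw [Set.inter_comm]; exact hS) IH huv.symm
      have hgu : ∀ i w, w ∈ Y i → w ∈ insert u (A ∩ B) → w = g i := by
        intro i w hw hw'
        rw [← hY6] at hw'
        obtain ⟨j, rfl⟩ := hw'
        by_contra hne
        have : j ≠ i := fun h => hne (h ▸ rfl)
        exact Set.disjoint_left.1 (hY2 this) (hY5 j) hw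
      have hhu : ∀ i w, w ∈ T i → w ∈ insert v (B ∩ A) → w = h i := by
        intro i w hw hw'
        rw [← hT6] at hw'
        obtain ⟨j, rfl⟩ := hw'
        by_contra hne
        have : j ≠ i := fun h => hne (h ▸ rfl)
        exact Set.disjoint_left.1 (hT2 this) (hT5 j) hw
      have hginj : ∀ i j, g i = g j → i = j := by
        intro i j hij
        by_contra hne
        exact Set.disjoint_left.1 (hY2 hne) (hY5 i) (hij ▸ hY5 j)
      have hσ : ∀ i, ∃ j, (h j = g i ∧ g i ∈ A ∩ B) ∨ (g i = u ∧ h j = v) := by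
        intro i
        have h1 : g i ∈ insert u (A ∩ B) := by rw [← hY6]; exact ⟨i, rfl⟩
        rcases h1 with h1 | h1
        · have : v ∈ Set.range h := by rw [hT6]; exact Or.inl rfl
          obtain ⟨j, hj⟩ := this
          exact ⟨j, Or.inr ⟨h1, hj⟩⟩
        · have : g i ∈ Set.range h := by rw [hT6]; exact Or.inr ⟨h1.2, h1.1⟩
          obtain ⟨j, hj⟩ := this
          exact ⟨j, Or.inl ⟨hj, h1⟩⟩
      choose σ hσ using hσ
      have hσinj : ∀ i j, σ i = σ j → i = j := by
        intro i j hij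
        apply hginj
        have h1 := hσ i
        have h2 := hσ j
        rw [hij] at h1
        rcases h1 with ⟨h1, h1'⟩ | ⟨h1, h1'⟩ <;> rcases h2 with ⟨h2, h2'⟩ | ⟨h2, h2'⟩
        · exact h1.symm.trans h2
        · rw [← h1, h2'] at h1'; exact absurd h1'.1 hv.2
        · rw [← h2, h1'] at h2'; exact absurd h2'.1 hv.2
        · exact h1.trans h2.symm
      have hcross : ∀ i j, i ≠ j → Disjoint (Y i) (T (σ j)) := by
        intro i j hij
        rw [Set.disjoint_left]
        intro w hwY hwT
        have hwS : w ∈ A ∩ B := ⟨hY4 _ hwY, hT4 _ hwT⟩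
        have e1 := hgu i w hwY (Or.inr hwS)
        have e2 := hhu _ w hwT (Or.inr ⟨hwS.2, hwS.1⟩)
        rcases hσ j with ⟨h2, h2'⟩ | ⟨h2, h2'⟩
        · exact hij (hginj _ _ (e1.symm.trans (e2.trans h2)))
        · rw [e2, h2'] at hwS; exact hv.2 hwS.1
      refine ⟨fun i => Y i ∪ T (σ i), ?_, ?_, ?_, ?_⟩
      · intro i
        rcases hσ i with ⟨h2, h2'⟩ | ⟨h2, h2'⟩
        · exact induce_union_connected (hY1 i).preconnected (hT1 _).preconnected
            ⟨g i, hY5 i, h2 ▸ hT5 _⟩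
        · exact connected_induce_union (hY1 i).preconnected (hT1 _).preconnected
            (h2 ▸ hY5 i) (h2' ▸ hT5 _) huv
      · intro i j hij
        simp only [Set.disjoint_union_left, Set.disjoint_union_right]
        exact ⟨⟨hY2 hij, (hcross j i hij.symm).symm⟩, hcross i j hij, hT2 fun h => hij (hσinj _ _ h)⟩
      · intro i
        exact (hY3 i).mono (Set.inter_subset_inter_left _ Set.subset_union_left)
      · intro i
        exact (hT3 _).mono (Set.inter_subset_inter_left _ Set.subset_union_right)
  · push Not at hbot
    have h := hG Z (Zᶜ ∪ W) ⟨by rw [← Set.union_assoc, Set.union_compl_self, Set.univ_union],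
      fun a _ b _ => hbot a b⟩ subset_rfl Set.subset_union_right
    have : Z ∩ (Zᶜ ∪ W) = Z ∩ W := by
      ext v; simp only [Set.mem_inter_iff, Set.mem_union, Set.mem_compl_iff]; tauto
    rw [this] at h
    obtain ⟨f, hf⟩ : ∃ f : Fin k → V, Function.Injective f ∧ ∀ i, f i ∈ Z ∩ W := by
      have : Nonempty (Fin k ↪ (Z ∩ W : Set V)) := by
        have := Fintype.ofFinite (Z ∩ W : Set V)
        apply Function.Embedding.nonempty_of_card_le
        rw [Fintype.card_fin, ← Nat.card_eq_fintype_card]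
        exact h
      obtain ⟨e⟩ := this
      exact ⟨fun i => (e i).1, fun i j hij => e.injective (Subtype.ext hij), fun i => (e i).2⟩
    refine ⟨fun i => {f i}, fun i => conn_singleton _ _, ?_, ?_, ?_⟩
    · intro i j hij
      simpa using fun h => hij (hf.1 h)
    · exact fun i => ⟨f i, rfl, (hf.2 i).1⟩
    · exact fun i => ⟨f i, rfl, (hf.2 i).2⟩

lemma trim {V : Type*} (G : SimpleGraph V) (s W : Set V) (hs : (G.induce s).Connected)
    (z : V) (hz : z ∈ s) (hW : (s ∩ W).Nonempty) :
    ∃ t ⊆ s, (G.induce t).Connected ∧ z ∈ t ∧ ∃ w, t ∩ W = {w} := by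
  obtain ⟨w, hws, hwW⟩ := hW
  have single : ∀ b ∈ s, b ∈ W →
      ∃ t ⊆ s, (G.induce t).Connected ∧ b ∈ t ∧ ∃ w, t ∩ W = {w} := by
    intro b hb hbW
    refine ⟨{b}, by simpa using hb, conn_singleton _ _, rfl, b, ?_⟩
    simpa using hbW
  refine ((conn_iff _ _).1 hs).2
    {v | ∃ t ⊆ s, (G.induce t).Connected ∧ v ∈ t ∧ ∃ w, t ∩ W = {w}}
    ⟨w, hws, single w hws hwW⟩ ?_ hz
  rintro a ha ⟨t, hts, htc, hat, w', hw'⟩ b hb hab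
  by_cases hbW : b ∈ W
  · exact single b hb hbW
  · refine ⟨t ∪ {b}, Set.union_subset hts (by simpa using hb), ?_, Or.inr rfl, w', ?_⟩
    · exact connected_induce_union htc.preconnected (conn_singleton G b).preconnected hat rfl hab
    · rw [Set.union_inter_distrib_right, hw']
      have : ({b} : Set V) ∩ W = ∅ := by simpa using hbW
      rw [this, Set.union_empty]

/-- counting: some bag avoids a small set -/
lemma exists_avoid {V : Type*} [Finite V] {p : ℕ} (X : Fin p → Set V)
    (hX : Pairwise fun i j => Disjoint (X i) (X j)) (J : Set (Fin p)) (T : Set V)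
    (h : T.ncard < J.ncard) : ∃ i ∈ J, Disjoint (X i) T := by
  by_contra hcon
  push Not at hcon
  have : ∀ i, ∃ v, i ∈ J → v ∈ X i ∧ v ∈ T := by
    intro i
    by_cases hi : i ∈ J
    · obtain ⟨v, hv⟩ := Set.not_disjoint_iff.1 (hcon i hi)
      exact ⟨v, fun _ => hv⟩
    · have : Nonempty V := by
        have : J.Nonempty := by
          rw [← Set.ncard_pos]; omega
        obtain ⟨j, hj⟩ := this
        obtain ⟨v, hv⟩ := Set.not_disjoint_iff.1 (hcon j hj)
        exact ⟨v⟩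
      exact ⟨Classical.arbitrary V, fun h => absurd h hi⟩
  choose g hg using this
  have := Set.ncard_le_ncard_of_injOn g (s := J) (t := T) (fun i hi => (hg i hi).2) (by
    intro i hi j hj hij
    by_contra hne
    exact Set.disjoint_left.1 (hX hne) (hg i hi).1 (hij ▸ (hg j hj).1)) (Set.toFinite _)
  omega

/-- a bag avoiding the separator lies on the side of any other bag -/
lemma bag_side {V : Type*} {G : SimpleGraph V} {p : ℕ} {X : Fin p → Set V}
    (hXconn : ∀ i, (G.induce (X i)).Connected)
    (hXadj : ∀ i j, i ≠ j → ∃ x ∈ X i, ∃ y ∈ X j, G.Adj x y)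
    {A B : Set V} (hAB : IsSeparation G A B) {i j : Fin p} (hi : X i ⊆ B \ A)
    (hj : Disjoint (X j) (A ∩ B)) : X j ⊆ B \ A := by
  by_cases hij : i = j
  · exact hij ▸ hi
  have step : ∀ a ∈ B \ A, ∀ b ∈ X j, G.Adj a b → b ∈ B \ A := by
    intro a ha b hb hab
    have hbAB : b ∉ A ∩ B := Set.disjoint_left.1 hj hb
    have hbu : b ∈ A ∪ B := by rw [hAB.1]; trivial
    by_cases hbA : b ∈ A
    · have hbB : b ∉ B := fun h => hbAB ⟨hbA, h⟩
      exact absurd hab.symm (hAB.2 b ⟨hbA, hbB⟩ a ha)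
    · exact ⟨hbu.resolve_left hbA, hbA⟩
  obtain ⟨x, hx, y, hy, hxy⟩ := hXadj i j hij
  exact ((conn_iff _ _).1 (hXconn j)).2 (B \ A) ⟨y, hy, step x (hi hx) y hy hxy⟩
    (fun a _ haT b hb hab => step a haT b hb hab)

lemma base_case {V : Type*} [Finite V] {k d p : ℕ} (G : SimpleGraph V)
    (z : Fin k → V) (hz : Function.Injective z) (X : Fin p → Set V)
    (hd : 0 < d)
    (hnosep : ¬ ∃ A B : Set V, IsSeparation G A B ∧ (A ∩ B).ncard < k ∧
      Set.range z ⊆ A ∧ ∃ i, X i ⊆ B \ A)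
    (hW : k + d ≤ {v | ∃ j, X j = {v}}.ncard) :
    ∃ Y : Fin k ⊕ Fin d → Set V, (∀ s, (G.induce (Y s)).Connected) ∧
      (Pairwise fun s t => Disjoint (Y s) (Y t)) ∧ (∀ s, ∃ j, X j ⊆ Y s) ∧
      ∀ i, z i ∈ Y (Sum.inl i) := by
  set W : Set V := {v | ∃ j, X j = {v}} with hWdef
  obtain ⟨Y, hY1, hY2, hY3, hY4⟩ := menger k G (Set.range z) W (by
    intro A B hAB hZ hWB
    by_contra hlt
    push Not at hlt
    have : ¬ W ⊆ A ∩ B := fun h => by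
      have := Set.ncard_le_ncard h (Set.toFinite _)
      omega
    obtain ⟨w, hw, hwn⟩ := Set.not_subset.1 this
    obtain ⟨j, hj⟩ := hw
    have hwB : w ∈ B := hWB ⟨j, hj⟩
    refine hnosep ⟨A, B, hAB, hlt, hZ, j, ?_⟩
    rw [hj]
    simpa using ⟨hwB, fun h => hwn ⟨h, hwB⟩⟩)
  have : ∀ i, ∃ j, z j ∈ Y i := by
    intro i
    obtain ⟨v, hv, j, rfl⟩ := hY3 i
    exact ⟨j, hv⟩
  choose τ hτ using this
  have hτinj : Function.Injective τ := by
    intro i j hij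
    by_contra hne
    exact Set.disjoint_left.1 (hY2 hne) (hτ i) (hij ▸ hτ j)
  let e : Fin k ≃ Fin k := Equiv.ofBijective τ (Finite.injective_iff_bijective.1 hτinj)
  have hze : ∀ i, z i ∈ Y (e.symm i) := by
    intro i
    have := hτ (e.symm i)
    rwa [show τ (e.symm i) = i from e.apply_symm_apply i] at this
  choose t ht1 ht2 ht3 w hw using fun i => trim G (Y (e.symm i)) W (hY1 _) (z i) (hze i) (hY4 _)
  have hwt : ∀ i, w i ∈ t i ∩ W := fun i => by rw [hw i]; rfl
  have hcard : d ≤ (W \ Set.range w).ncard := by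
    have h1 := Set.ncard_le_ncard_sdiff_add_ncard W (Set.range w)
    have h2 : (Set.range w).ncard ≤ k := by
      rw [← Set.image_univ]
      refine (Set.ncard_image_le (Set.toFinite _)).trans ?_
      rw [Set.ncard_univ, Nat.card_fin]
    omega
  obtain ⟨g⟩ : Nonempty (Fin d ↪ (W \ Set.range w : Set V)) := by
    have := Fintype.ofFinite (W \ Set.range w : Set V)
    apply Function.Embedding.nonempty_of_card_le
    rw [Fintype.card_fin, ← Nat.card_eq_fintype_card]
    exact hcard
  have htd : ∀ i j, i ≠ j → Disjoint (t i) (t j) := by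
    intro i j hij
    exact Set.disjoint_of_subset (ht1 i) (ht1 j) (hY2 fun h => hij (e.symm.injective h))
  have htg : ∀ i j, (g j).1 ∉ t i := by
    intro i j h
    have : (g j).1 ∈ t i ∩ W := ⟨h, (g j).2.1⟩
    rw [hw i] at this
    exact (g j).2.2 ⟨i, this.symm⟩
  refine ⟨Sum.elim t fun j => {(g j).1}, ?_, ?_, ?_, ?_⟩
  · rintro (i | j)
    · exact ht2 i
    · exact conn_singleton _ _
  · rintro (i | i) (j | j) hij
    · exact htd i j fun h => hij (h ▸ rfl)
    · simpa using htg i j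
    · simpa using htg j i
    · have : (g i).1 ≠ (g j).1 := fun h => hij (congrArg _ (g.injective (Subtype.ext h)))
      simpa using this
  · rintro (i | j)
    · obtain ⟨j, hj⟩ := (hwt i).2
      exact ⟨j, by rw [hj]; simpa using (hwt i).1⟩
    · obtain ⟨i, hi⟩ := (g j).2.1
      exact ⟨i, hi.subset⟩
  · exact fun i => ht3 i

lemma exists_contract {V : Type} [Fintype V] (x y : V) (hxy : x ≠ y) :
    ∃ (V' : Type) (_ : Fintype V') (f : V → V'), Fintype.card V' < Fintype.card V ∧
      Function.Surjective f ∧ f x = f y ∧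
      ∀ a b, f a = f b → a = b ∨ (a = x ∧ b = y) ∨ (a = y ∧ b = x) := by
  classical
  refine ⟨{v // v ≠ y}, inferInstance, fun v => if h : v = y then ⟨x, hxy⟩ else ⟨v, h⟩,
    ?_, ?_, ?_, ?_⟩
  · exact Fintype.card_subtype_lt (x := y) (by simp)
  · rintro ⟨v, hv⟩
    exact ⟨v, by simp [hv]⟩
  · simp [hxy]
  · intro a b hab
    by_cases ha : a = y <;> by_cases hb : b = y
    · exact Or.inl (ha.trans hb.symm)
    · simp [ha, hb] at hab
      exact Or.inr (Or.inr ⟨ha, hab.symm⟩)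
    · simp [ha, hb] at hab
      exact Or.inr (Or.inl ⟨hab, hb⟩)
    · simp [ha, hb] at hab
      exact Or.inl hab

theorem core {k d p : ℕ} (hd : 0 < d) (hp : 2 * k + d ≤ p) (N : ℕ) :
    ∀ (V : Type) [Fintype V], Fintype.card V = N → ∀ (G : SimpleGraph V)
    (z : Fin k → V), Function.Injective z → ∀ (X : Fin p → Set V),
    (∀ i, (G.induce (X i)).Connected) →
    (Pairwise fun i j => Disjoint (X i) (X j)) →
    (∀ i j, i ≠ j → ∃ x ∈ X i, ∃ y ∈ X j, G.Adj x y) →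
    (¬ ∃ A B : Set V, IsSeparation G A B ∧ (A ∩ B).ncard < k ∧
      Set.range z ⊆ A ∧ ∃ i, X i ⊆ B \ A) →
    ∃ Y : Fin k ⊕ Fin d → Set V, (∀ s, (G.induce (Y s)).Connected) ∧
      (Pairwise fun s t => Disjoint (Y s) (Y t)) ∧ (∀ s, ∃ j, X j ⊆ Y s) ∧
      ∀ i, z i ∈ Y (Sum.inl i) := by
  classical
  induction N using Nat.strong_induction_on with
  | _ N IH =>
  intro V _ hN G z hz X hXconn hXdisj hXadj hnosep
  by_cases hW : k + d ≤ {v | ∃ j, X j = {v}}.ncard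
  · exact base_case G z hz X hd hnosep hW
  push Not at hW
  -- a separation of order `k` with maximal `A`
  have hrange : (Set.range z).ncard = k := by
    rw [← Set.image_univ, Set.ncard_image_of_injective _ hz, Set.ncard_univ, Nat.card_fin]
  have hunivp : (Set.univ : Set (Fin p)).ncard = p := by rw [Set.ncard_univ, Nat.card_fin]
  let P : Set V → Prop := fun A => ∃ B, IsSeparation G A B ∧ (A ∩ B).ncard = k ∧
      Set.range z ⊆ A ∧ ∃ i, X i ⊆ B \ A
  have hP0 : P (Set.range z) := by
    obtain ⟨i, -, hi⟩ := exists_avoid X hXdisj Set.univ (Set.range z) (by omega)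
    refine ⟨Set.univ, ⟨by simp, fun a ha => absurd (Set.mem_univ a) ha.2⟩, by simpa using hrange,
      subset_rfl, i, fun v hv => ⟨trivial, Set.disjoint_left.1 hi hv⟩⟩
  obtain ⟨A, -, hAmax⟩ := (Set.toFinite {A | P A}).exists_le_maximal hP0
  obtain ⟨B, hAB, hord, hZA, i₀, hi₀⟩ := hAmax.1
  -- a non-singleton bag avoiding `A ∩ B`
  have hJ : k < {j : Fin p | ∀ v, X j ≠ {v}}.ncard := by
    have h1 : {j : Fin p | ∀ v, X j ≠ {v}}ᶜ.ncard ≤ {v | ∃ j, X j = {v}}.ncard := by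
      have : ∀ j, ∃ v, v ∈ X j ∧ ((∃ v, X j = {v}) → X j = {v}) := by
        intro j
        obtain ⟨v, hv⟩ := ((conn_iff _ _).1 (hXconn j)).1
        refine ⟨v, hv, ?_⟩
        rintro ⟨w, hw⟩
        rw [hw] at hv ⊢
        rw [Set.mem_singleton_iff.1 hv]
      choose g hg using this
      refine Set.ncard_le_ncard_of_injOn g ?_ ?_ (Set.toFinite _)
      · intro j hj
        have : ∃ v, X j = {v} := by simpa using hj
        exact ⟨j, (hg j).2 this⟩
      · intro i _ j _ hij
        by_contra hne
        exact Set.disjoint_left.1 (hXdisj hne) (hg i).1 (hij ▸ (hg j).1)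
    have h2 := Set.ncard_add_ncard_compl {j : Fin p | ∀ v, X j ≠ {v}}
    rw [Nat.card_fin] at h2
    omega
  obtain ⟨j₀, hj₀, hj₀d⟩ := exists_avoid X hXdisj _ (A ∩ B) (by rw [hord]; exact hJ)
  have hj₀s : X j₀ ⊆ B \ A := bag_side hXconn hXadj hAB hi₀ hj₀d
  obtain ⟨x, hx, y, hy, hxy⟩ : ∃ x ∈ X j₀, ∃ y ∈ X j₀, G.Adj x y := by
    obtain ⟨v, hv⟩ := ((conn_iff _ _).1 (hXconn j₀)).1
    by_contra hcon
    push Not at hcon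
    apply hj₀ v
    apply Set.Subset.antisymm
    · exact ((conn_iff _ _).1 (hXconn j₀)).2 {v} ⟨v, hv, rfl⟩
        (fun a ha _ b hb hab => absurd hab (hcon a ha b hb))
    · simpa using hv
  obtain ⟨V', _, f, hcard, hsurj, hfxy, hfib⟩ := exists_contract x y hxy.ne
  let G' : SimpleGraph V' :=
    { Adj := fun a b => a ≠ b ∧ ∃ u v, f u = a ∧ f v = b ∧ G.Adj u v
      symm := ⟨fun a b h => ⟨h.1.symm, by
        obtain ⟨u, v, h1, h2, h3⟩ := h.2
        exact ⟨v, u, h2, h1, h3.symm⟩⟩⟩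
      loopless := ⟨fun a h => h.1 rfl⟩ }
  have hpre : ∀ s : Set V', (G'.induce s).Connected → (G.induce (f ⁻¹' s)).Connected := by
    intro s hs
    rw [conn_iff] at hs ⊢
    obtain ⟨⟨a, ha⟩, hs⟩ := hs
    obtain ⟨a, rfl⟩ := hsurj a
    refine ⟨⟨a, ha⟩, ?_⟩
    rintro T ⟨b, hb, hbT⟩ hcl
    have hfibT : ∀ u v, f u = f v → f u ∈ s → u ∈ T → v ∈ T := by
      intro u v huv hus huT
      rcases hfib u v huv with rfl | ⟨rfl, rfl⟩ | ⟨rfl, rfl⟩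
      · exact huT
      · exact hcl u hus huT v (by simpa [← huv] using hus) hxy
      · exact hcl u hus huT v (by simpa [← huv] using hus) hxy.symm
    have := hs (f '' T) ⟨f b, hb, b, hbT, rfl⟩ (by
      rintro _ hc ⟨c, hcT, rfl⟩ e he ⟨-, u, v, hu, rfl, huv⟩
      have huT : u ∈ T := hfibT c u hu.symm hc hcT
      exact ⟨v, hcl u (by simpa [hu] using hc) huT v he huv, rfl⟩)
    intro v hv
    obtain ⟨u, hu, huv⟩ := this hv
    exact hfibT u v huv (by rw [huv]; exact hv) hu
  have him : ∀ s : Set V, (G.induce s).Connected → (G'.induce (f '' s)).Connected := by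
    intro s hs
    rw [conn_iff] at hs ⊢
    obtain ⟨⟨a, ha⟩, hs⟩ := hs
    refine ⟨⟨f a, a, ha, rfl⟩, ?_⟩
    rintro T ⟨_, ⟨b, hb, rfl⟩, hbT⟩ hcl
    rw [Set.image_subset_iff]
    refine hs _ ⟨b, hb, hbT⟩ ?_
    intro u hu huT v hv huv
    by_cases h : f u = f v
    · show f v ∈ T
      rw [← h]; exact huT
    · exact hcl (f u) ⟨u, hu, rfl⟩ huT (f v) ⟨v, hv, rfl⟩ ⟨h, u, v, rfl, rfl, huv⟩
  have hz' : Function.Injective (f ∘ z) := by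
    intro i j hij
    have hxA : ∀ i, z i ≠ x := fun i h => (hj₀s hx).2 (h ▸ hZA ⟨i, rfl⟩)
    rcases hfib _ _ hij with h | h | h
    · exact hz h
    · exact absurd h.1 (hxA i)
    · exact absurd h.2 (hxA j)
  have hdisj' : ∀ i j, i ≠ j → ∀ u ∈ X i, ∀ v ∈ X j, f u ≠ f v := by
    intro i j hij u hu v hv huv
    have hbag : ∀ i, x ∈ X i ∨ y ∈ X i → i = j₀ := by
      intro i h
      by_contra hne
      rcases h with h | h
      · exact Set.disjoint_left.1 (hXdisj hne) h hx
      · exact Set.disjoint_left.1 (hXdisj hne) h hy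
    rcases hfib _ _ huv with rfl | ⟨rfl, rfl⟩ | ⟨rfl, rfl⟩
    · exact Set.disjoint_left.1 (hXdisj hij) hu hv
    · exact hij ((hbag i (Or.inl hu)).trans (hbag j (Or.inr hv)).symm)
    · exact hij ((hbag i (Or.inr hu)).trans (hbag j (Or.inl hv)).symm)
  have hnosep' : ¬ ∃ A B : Set V', IsSeparation G' A B ∧ (A ∩ B).ncard < k ∧
      Set.range (f ∘ z) ⊆ A ∧ ∃ i, f '' (X i) ⊆ B \ A := by
    rintro ⟨A₁, B₁, hAB₁, hord₁, hZ₁, i₁, hi₁⟩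
    set A' := f ⁻¹' A₁ with hA'
    set B' := f ⁻¹' B₁ with hB'
    have hsep' : IsSeparation G A' B' := by
      constructor
      · rw [hA', hB', ← Set.preimage_union, hAB₁.1, Set.preimage_univ]
      · rintro a ⟨ha, ha'⟩ b ⟨hb, hb'⟩ hab
        refine hAB₁.2 (f a) ⟨ha, ha'⟩ (f b) ⟨hb, hb'⟩ ⟨?_, a, b, rfl, rfl, hab⟩
        intro h
        apply hb'
        show f b ∈ A₁
        rw [← h]; exact ha
    have hZ' : Set.range z ⊆ A' := by
      rintro _ ⟨i, rfl⟩
      exact hZ₁ ⟨i, rfl⟩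
    have hi' : X i₁ ⊆ B' \ A' := fun v hv => hi₁ ⟨v, hv, rfl⟩
    have hge : k ≤ (A' ∩ B').ncard := by
      by_contra hlt
      push Not at hlt
      exact hnosep ⟨A', B', hsep', hlt, hZ', i₁, hi'⟩
    have hinj : ((A' ∩ B') \ {y}).ncard ≤ (A₁ ∩ B₁).ncard := by
      refine Set.ncard_le_ncard_of_injOn f (fun v hv => hv.1) ?_ (Set.toFinite _)
      intro a ha b hb hab
      rcases hfib a b hab with h | h | h
      · exact h
      · exact absurd h.2 hb.2
      · exact absurd h.1 ha.2
    have hyS : y ∈ A' ∩ B' := by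
      by_contra hn
      rw [Set.sdiff_singleton_eq_self hn] at hinj
      omega
    have hle : (A' ∩ B').ncard ≤ k := by
      have := Set.ncard_sdiff_singleton_add_one hyS (Set.toFinite _)
      omega
    -- uncrossing
    obtain ⟨i₂, -, hi₂⟩ := exists_avoid X hXdisj Set.univ ((A ∩ B) ∪ (A' ∩ B')) (by
      have := Set.ncard_union_le (A ∩ B) (A' ∩ B')
      omega)
    rw [Set.disjoint_union_right] at hi₂
    have hi₂1 := bag_side hXconn hXadj hAB hi₀ hi₂.1
    have hi₂2 := bag_side hXconn hXadj hsep' hi' hi₂.2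
    have hu1 : ∀ v, v ∈ A ∨ v ∈ B := fun v => by
      have : v ∈ A ∪ B := by rw [hAB.1]; trivial
      exact this
    have hu2 : ∀ v, v ∈ A' ∨ v ∈ B' := fun v => by
      have : v ∈ A' ∪ B' := by rw [hsep'.1]; trivial
      exact this
    have hs1 : IsSeparation G (A ∪ A') (B ∩ B') := by
      constructor
      · ext v
        have := hu1 v; have := hu2 v
        simp only [Set.mem_union, Set.mem_inter_iff, Set.mem_univ, iff_true]
        tauto
      · rintro a ⟨ha, ha'⟩ b ⟨hb, hb'⟩ hab
        have h1 := hAB.2 a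
        have h2 := hsep'.2 a
        have hbA : b ∉ A := fun h => hb' (Or.inl h)
        have hbA' : b ∉ A' := fun h => hb' (Or.inr h)
        have ha1 := hu1 a
        have ha2 := hu2 a
        by_cases haB : a ∈ B
        · have haB' : a ∉ B' := fun h => ha' ⟨haB, h⟩
          exact h2 ⟨ha2.resolve_right haB', haB'⟩ b ⟨hb.2, hbA'⟩ hab
        · exact h1 ⟨ha1.resolve_right haB, haB⟩ b ⟨hb.1, hbA⟩ hab
    have hs2 : IsSeparation G (A ∩ A') (B ∪ B') := by
      constructor
      · ext v
        have := hu1 v; have := hu2 v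
        simp only [Set.mem_union, Set.mem_inter_iff, Set.mem_univ, iff_true]
        tauto
      · rintro a ⟨ha, ha'⟩ b ⟨hb, hb'⟩ hab
        have haB : a ∉ B := fun h => ha' (Or.inl h)
        have haB' : a ∉ B' := fun h => ha' (Or.inr h)
        by_cases hbA : b ∈ A
        · have hbA' : b ∉ A' := fun h => hb' ⟨hbA, h⟩
          exact hsep'.2 a ⟨ha.2, haB'⟩ b ⟨(hu2 b).resolve_left hbA', hbA'⟩ hab
        · exact hAB.2 a ⟨ha.1, haB⟩ b ⟨(hu1 b).resolve_left hbA, hbA⟩ hab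
    have hc2 : k ≤ ((A ∩ A') ∩ (B ∪ B')).ncard := by
      by_contra hlt
      push Not at hlt
      exact hnosep ⟨_, _, hs2, hlt, Set.subset_inter hZA hZ', i₀,
        fun v hv => ⟨Or.inl (hi₀ hv).1, fun h => (hi₀ hv).2 h.1⟩⟩
    have hZ1 : Set.range z ⊆ A ∪ A' := hZA.trans Set.subset_union_left
    have hb1 : X i₂ ⊆ (B ∩ B') \ (A ∪ A') := fun v hv =>
      ⟨⟨(hi₂1 hv).1, (hi₂2 hv).1⟩, fun h => h.elim (hi₂1 hv).2 (hi₂2 hv).2⟩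
    have hc1 : k ≤ ((A ∪ A') ∩ (B ∩ B')).ncard := by
      by_contra hlt
      push Not at hlt
      exact hnosep ⟨_, _, hs1, hlt, hZ1, i₂, hb1⟩
    have hsum : ((A ∪ A') ∩ (B ∩ B')).ncard + ((A ∩ A') ∩ (B ∪ B')).ncard ≤
        (A ∩ B).ncard + (A' ∩ B').ncard := by
      rw [← Set.ncard_union_add_ncard_inter (A ∩ B) (A' ∩ B'),
        ← Set.ncard_union_add_ncard_inter ((A ∪ A') ∩ (B ∩ B'))]
      apply Nat.add_le_add <;> refine Set.ncard_le_ncard ?_ (Set.toFinite _)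
      · intro v
        simp only [Set.mem_union, Set.mem_inter_iff]
        tauto
      · intro v
        simp only [Set.mem_union, Set.mem_inter_iff]
        tauto
    have hPu : P (A ∪ A') := ⟨B ∩ B', hs1, by omega, hZ1, i₂, hb1⟩
    exact (hj₀s hy).2 (hAmax.2 hPu Set.subset_union_left (Or.inr hyS.1))
  obtain ⟨Y, hY1, hY2, hY3, hY4⟩ := IH (Fintype.card V') (hN ▸ hcard) V' rfl G' (f ∘ z) hz'
    (fun i => f '' X i) (fun i => him _ (hXconn i))
    (fun i j hij => Set.disjoint_left.2 (by
      rintro _ ⟨u, hu, rfl⟩ ⟨v, hv, huv⟩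
      exact hdisj' i j hij u hu v hv huv.symm))
    (fun i j hij => by
      obtain ⟨u, hu, v, hv, huv⟩ := hXadj i j hij
      exact ⟨f u, ⟨u, hu, rfl⟩, f v, ⟨v, hv, rfl⟩, hdisj' i j hij u hu v hv, u, v, rfl, rfl, huv⟩)
    hnosep'
  refine ⟨fun s => f ⁻¹' Y s, fun s => hpre _ (hY1 s), fun s t hst => (hY2 hst).preimage f, ?_,
    fun i => hY4 i⟩
  intro s
  obtain ⟨j, hj⟩ := hY3 s
  exact ⟨j, Set.image_subset_iff.1 hj⟩

end GF


/-- If `(G, χ)` has a colorful minor model of the rainbow `K_p` with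
`p ≥ ⌊5/2·k⌋ + 3d` which cannot be separated from the `k` roots `z` by fewer than `k`
vertices, then the `d`-folio of `(G, χ)` relative to the roots is generic: it contains
every rooted `q`-colorful graph with `k` roots of detail at most `d`. -/
theorem generic_folio_of_rainbow_clique (q d k p : ℕ) (hd : 0 < d) (hk : 0 < k)
    (hp : 5 * k / 2 + 3 * d ≤ p)
    {n : ℕ} (G : SimpleGraph (Fin n)) (χ : Fin n → Finset (Fin q))
    (z : Fin k → Fin n) (hz : Function.Injective z)
    (X : Fin p → Set (Fin n))
    (hXconn : ∀ i, (G.induce (X i)).Connected)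
    (hXdisj : Pairwise fun i j => Disjoint (X i) (X j))
    (hXadj : ∀ i j, i ≠ j → ∃ x ∈ X i, ∃ y ∈ X j, G.Adj x y)
    (hXrainbow : ∀ i, ∀ c : Fin q, ∃ x ∈ X i, c ∈ χ x)
    (hnosep : ¬ ∃ A B : Set (Fin n), IsSeparation G A B ∧ (A ∩ B).ncard < k ∧
      Set.range z ⊆ A ∧ ∃ i, X i ⊆ B \ A) :
    ∀ (m : ℕ) (H : SimpleGraph (Fin m)) (ψ : Fin m → Finset (Fin q))
        (u : Fin k → Fin m),
      H.edgeSet.ncard ≤ d → {a : Fin m | a ∉ Set.range u}.ncard ≤ d →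
      RootedMinorIn G χ Set.univ z H ψ u := by
  classical
  intro m H ψ u _ hu
  obtain ⟨Y, hY1, hY2, hY3, hY4⟩ := GF.core (k := k) (d := d) (p := p) hd (by omega) n (Fin n)
    (Fintype.card_fin n) G z hz X hXconn hXdisj hXadj hnosep
  choose b hb using hY3
  have hadj : ∀ s t, s ≠ t → ∃ x ∈ Y s, ∃ y ∈ Y t, G.Adj x y := by
    intro s t hst
    have hne : b s ≠ b t := by
      intro h
      obtain ⟨v, hv⟩ := ((GF.conn_iff _ _).1 (hXconn (b s))).1
      exact Set.disjoint_left.1 (hY2 hst) (hb s hv) (hb t (h ▸ hv))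
    obtain ⟨x, hx, y, hy, hxy⟩ := hXadj _ _ hne
    exact ⟨x, hb s hx, y, hb t hy, hxy⟩
  obtain ⟨g⟩ : Nonempty ({a : Fin m | a ∉ Set.range u} ↪ Fin d) := by
    apply Function.Embedding.nonempty_of_card_le
    rw [Fintype.card_fin, ← Nat.card_eq_fintype_card]
    exact hu
  -- the pieces belonging to a vertex of `H`
  let F : Fin k ⊕ Fin d → Fin m → Prop := fun s a =>
    (∃ i, s = Sum.inl i ∧ u i = a) ∨ (∃ h : a ∉ Set.range u, s = Sum.inr (g ⟨a, h⟩))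
  have hF1 : ∀ a, ∃ s, F s a := by
    intro a
    by_cases h : a ∈ Set.range u
    · obtain ⟨i, hi⟩ := h
      exact ⟨_, Or.inl ⟨i, rfl, hi⟩⟩
    · exact ⟨_, Or.inr ⟨h, rfl⟩⟩
  have hF2 : ∀ s a a', F s a → F s a' → a = a' := by
    rintro s a a' (⟨i, rfl, rfl⟩ | ⟨h, rfl⟩) (⟨i', hi, rfl⟩ | ⟨h', hh⟩)
    · rw [Sum.inl.inj hi]
    · cases hh
    · cases hi
    · have := g.injective (Sum.inr.inj hh)
      exact congrArg Subtype.val this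
  refine ⟨fun a => ⋃ s ∈ {s | F s a}, Y s, fun a => Set.subset_univ _, ?_, ?_, ?_, ?_, ?_⟩
  · intro a
    rw [GF.conn_iff]
    obtain ⟨s₀, hs₀⟩ := hF1 a
    obtain ⟨v₀, hv₀⟩ := ((GF.conn_iff _ _).1 (hY1 s₀)).1
    refine ⟨⟨v₀, Set.mem_biUnion hs₀ hv₀⟩, ?_⟩
    rintro T ⟨v, hv, hvT⟩ hcl
    obtain ⟨s, hs, hvs⟩ := Set.mem_iUnion₂.1 hv
    have hall : ∀ t, F t a → (∃ w ∈ Y t, w ∈ T) → Y t ⊆ T := by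
      intro t ht hw
      exact ((GF.conn_iff _ _).1 (hY1 t)).2 T hw fun c hc hcT e he hce =>
        hcl c (Set.mem_biUnion ht hc) hcT e (Set.mem_biUnion ht he) hce
    intro w hw
    obtain ⟨t, ht, hwt⟩ := Set.mem_iUnion₂.1 hw
    have hsT := hall s hs ⟨v, hvs, hvT⟩
    by_cases hst : s = t
    · exact hsT (hst ▸ hwt)
    · obtain ⟨c, hc, e, he, hce⟩ := hadj s t hst
      exact hall t ht ⟨e, he, hcl c (Set.mem_biUnion hs hc) (hsT hc) e
        (Set.mem_biUnion ht he) hce⟩ hwt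
  · intro a a' haa
    rw [Set.disjoint_left]
    intro v hv hv'
    obtain ⟨s, hs, hvs⟩ := Set.mem_iUnion₂.1 hv
    obtain ⟨t, ht, hvt⟩ := Set.mem_iUnion₂.1 hv'
    have hst : s ≠ t := by
      rintro rfl
      exact haa (hF2 _ _ _ hs ht)
    exact Set.disjoint_left.1 (hY2 hst) hvs hvt
  · intro a a' haa
    obtain ⟨s, hs⟩ := hF1 a
    obtain ⟨t, ht⟩ := hF1 a'
    have hst : s ≠ t := by
      rintro rfl
      exact haa.ne (hF2 _ _ _ hs ht)
    obtain ⟨x, hx, y, hy, hxy⟩ := hadj s t hst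
    exact ⟨x, Set.mem_biUnion hs hx, y, Set.mem_biUnion ht hy, hxy⟩
  · intro a c _
    obtain ⟨s, hs⟩ := hF1 a
    obtain ⟨x, hx, hc⟩ := hXrainbow (b s) c
    exact ⟨x, Set.mem_biUnion hs (hb s hx), hc⟩
  · intro i
    exact Set.mem_biUnion (show F (Sum.inl i) (u i) from Or.inl ⟨i, rfl, rfl⟩) (hY4 i)
end

section
/- There exists a universal constant c > 1 with the following property: for every integer r ≥ 2 there is a family A_r of at least c^{r³} pairwise non-isomorphic connected graphs such that no member of A_r is a minor of another member, every member of A_r contains K_r as a minor, and every member of A_r has at most C·r²·log r vertices for some universal constant C. -/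
open SimpleGraph

/-- `H` is a minor of `G`. -/
def HasMinorOf {α β : Type*} (H : SimpleGraph α) (G : SimpleGraph β) : Prop :=
  ∃ B : α → Set β,
    (∀ v, (G.induce (B v)).Connected) ∧
    (Pairwise fun u v => Disjoint (B u) (B v)) ∧
    (∀ u v, H.Adj u v → ∃ x ∈ B u, ∃ y ∈ B v, G.Adj x y)


/-- base graph on `Fin k ⊕ Fin k × Bool` -/
def baseGraph (k : ℕ) (f : Fin k → Fin k → Bool) : SimpleGraph (Fin k ⊕ Fin k × Bool) where
  Adj u v := match u, v with
    | Sum.inl _, Sum.inl _ => False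
    | Sum.inl i, Sum.inr p => f i p.1 = p.2
    | Sum.inr p, Sum.inl i => f i p.1 = p.2
    | Sum.inr p, Sum.inr q => p ≠ q
  symm := ⟨by
    rintro (i | p) (j | q) h
    · exact h
    · exact h
    · exact h
    · exact Ne.symm h⟩
  loopless := ⟨by
    rintro (i | p) h
    · exact h
    · exact h rfl⟩

theorem baseGraph_inj (k : ℕ) : Function.Injective (baseGraph k) := by
  intro f g h
  funext i j
  have : (baseGraph k g).Adj (Sum.inl i) (Sum.inr (j, f i j)) := by
    rw [← h]; exact (rfl : f i j = f i j)
  have h2 : g i j = f i j := this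
  exact h2.symm

open Classical in
theorem baseGraph_count (k : ℕ) (f g : Fin k → Fin k → Bool) :
    (∑ u, ∑ v, if (baseGraph k f).Adj u v then 1 else 0) =
    (∑ u, ∑ v, if (baseGraph k g).Adj u v then 1 else 0 : ℕ) := by
  have key : ∀ f : Fin k → Fin k → Bool, 
    (∑ u, ∑ v, if (baseGraph k f).Adj u v then 1 else 0 : ℕ) = k * k + (k * k +
      ∑ p : Fin k × Bool, ∑ q : Fin k × Bool, if p ≠ q then 1 else 0) := by
    intro f
    have h1 : ∀ i j, (∑ b : Bool, if f i j = b then 1 else 0 : ℕ) = 1 := by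
      intro i j; simp
    have e1 : (∑ i : Fin k, ∑ p : Fin k × Bool, if f i p.1 = p.2 then 1 else 0 : ℕ) = k * k := by
      simp only [Fintype.sum_prod_type, h1]; simp
    rw [Fintype.sum_sum_type]
    have a1 : ∀ i j, (baseGraph k f).Adj (Sum.inl i) (Sum.inl j) ↔ False := fun i j => Iff.rfl
    have a2 : ∀ i p, (baseGraph k f).Adj (Sum.inl i) (Sum.inr p) ↔ f i p.1 = p.2 :=
      fun i p => Iff.rfl
    have a3 : ∀ i p, (baseGraph k f).Adj (Sum.inr p) (Sum.inl i) ↔ f i p.1 = p.2 :=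
      fun i p => Iff.rfl
    have a4 : ∀ p q, (baseGraph k f).Adj (Sum.inr p) (Sum.inr q) ↔ p ≠ q := fun i p => Iff.rfl
    simp only [Fintype.sum_sum_type, a1, a2, a3, a4, Finset.sum_add_distrib]
    rw [Finset.sum_comm (s := (Finset.univ : Finset (Fin k × Bool))) (t := (Finset.univ : Finset (Fin k)))]
    simp only [e1]
    simp
  rw [key f, key g]

theorem baseGraph_conn (k : ℕ) (hk : 0 < k) (f : Fin k → Fin k → Bool) :
    (baseGraph k f).Connected := by
  let z : Fin k × Bool := (⟨0, hk⟩, true)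
  have hz : ∀ v, (baseGraph k f).Reachable v (Sum.inr z) := by
    have hr : ∀ p, (baseGraph k f).Reachable (Sum.inr p) (Sum.inr z) := by
      intro p
      by_cases h : p = z
      · rw [h]
      · exact Adj.reachable (show p ≠ z from h)
    rintro (i | p)
    · refine Reachable.trans (Adj.reachable (v := Sum.inr (⟨0, hk⟩, f i ⟨0, hk⟩)) ?_) (hr _)
      exact (rfl : f i _ = f i _)
    · exact hr p
  have : Nonempty (Fin k ⊕ Fin k × Bool) := ⟨Sum.inr z⟩
  exact Connected.mk (fun u v => (hz u).trans (hz v).symm)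

/-- A minor on the same vertex set is given by a permutation. -/
theorem minor_perm {n : ℕ} {H G : SimpleGraph (Fin n)} (h : HasMinorOf H G) :
    ∃ σ : Equiv.Perm (Fin n), ∀ u v, H.Adj u v → G.Adj (σ u) (σ v) := by
  obtain ⟨B, hc, hd, ha⟩ := h
  have hne : ∀ v, ∃ x, x ∈ B v := fun v => by
    obtain ⟨⟨x, hx⟩⟩ := (hc v).nonempty
    exact ⟨x, hx⟩
  choose s hs using hne
  have huniq : ∀ {x u v}, x ∈ B u → x ∈ B v → u = v := by
    intro x u v hu hv
    by_contra hne
    exact Set.disjoint_left.1 (hd hne) hu hv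
  have hinj : Function.Injective s := fun u v huv => huniq (hs u) (huv ▸ hs v)
  have hbij : Function.Bijective s := Finite.injective_iff_bijective.1 hinj
  have hB : ∀ v x, x ∈ B v → x = s v := by
    intro v x hx
    obtain ⟨w, rfl⟩ := hbij.2 x
    rw [huniq (hs w) hx]
  refine ⟨Equiv.ofBijective s hbij, fun u v huv => ?_⟩
  obtain ⟨x, hx, y, hy, hxy⟩ := ha u v huv
  rw [hB u x hx, hB v y hy] at hxy
  exact hxy

open Classical in
theorem iso_of_perm {n : ℕ} {H G : SimpleGraph (Fin n)} (σ : Equiv.Perm (Fin n))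
    (h : ∀ u v, H.Adj u v → G.Adj (σ u) (σ v))
    (hcount : (∑ u, ∑ v, if H.Adj u v then 1 else 0 : ℕ) =
      ∑ u, ∑ v, if G.Adj u v then 1 else 0) : Nonempty (H ≃g G) := by
  have e : (∑ u, ∑ v, if G.Adj u v then 1 else 0 : ℕ) =
      ∑ u, ∑ v, if G.Adj (σ u) (σ v) then 1 else 0 := by
    rw [← Equiv.sum_comp σ]
    refine Finset.sum_congr rfl fun u _ => ?_
    rw [← Equiv.sum_comp σ]
  rw [e, ← Finset.sum_product', ← Finset.sum_product'] at hcount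
  have hle : ∀ p ∈ (Finset.univ : Finset (Fin n)) ×ˢ (Finset.univ : Finset (Fin n)),
      (if H.Adj p.1 p.2 then 1 else 0 : ℕ) ≤ if G.Adj (σ p.1) (σ p.2) then 1 else 0 := by
    intro p _
    by_cases hp : H.Adj p.1 p.2
    · simp [hp, h _ _ hp]
    · simp [hp]
  have := (Finset.sum_eq_sum_iff_of_le hle).1 hcount
  refine ⟨⟨σ, ?_⟩⟩
  intro u v
  have huv := this (u, v) (by simp)
  constructor
  · intro hg
    by_contra hH
    simp_all
  · exact h u v

theorem num_bound (r : ℕ) (hr : 2 ≤ r) :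
    2 ^ (r ^ 3) * (192 * r ^ 2).factorial ≤ 2 ^ ((64 * r ^ 2) * (64 * r ^ 2)) := by
  have hm : ∀ m : ℕ, 1 ≤ m → 192 * m ≤ 2 ^ (8 * m) := by
    intro m hm
    induction m, hm using Nat.le_induction with
    | base => norm_num
    | succ m hm ih =>
      have : 2 ^ (8 * (m + 1)) = 2 ^ (8 * m) * 256 := by rw [mul_add, pow_add]; norm_num
      omega
  have h1 := hm (r ^ 2) (Nat.one_le_pow _ _ (by omega))
  calc 2 ^ (r ^ 3) * (192 * r ^ 2).factorial
      ≤ 2 ^ (r ^ 3) * (192 * r ^ 2) ^ (192 * r ^ 2) :=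
        Nat.mul_le_mul_left _ (Nat.factorial_le_pow _)
    _ ≤ 2 ^ (r ^ 3) * (2 ^ (8 * r ^ 2)) ^ (192 * r ^ 2) :=
        Nat.mul_le_mul_left _ (Nat.pow_le_pow_left h1 _)
    _ = 2 ^ (r ^ 3 + 8 * r ^ 2 * (192 * r ^ 2)) := by rw [← pow_mul, ← pow_add]
    _ ≤ _ := by
        apply Nat.pow_le_pow_right (by norm_num)
        have : r ^ 3 ≤ r ^ 4 := Nat.pow_le_pow_right (by omega) (by norm_num)
        nlinarith

/-- There is a universal `c > 1` and a universal `C > 0` such that for every `r ≥ 2`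
there is a family of at least `c^(r³)` pairwise non-isomorphic connected graphs forming
a minor anti-chain, each containing `K_r` as a minor, each with at most `C·r²·log r`
vertices. -/
theorem minor_antichain_family :
    ∃ c C : ℝ, 1 < c ∧ 0 < C ∧
      ∀ r : ℕ, 2 ≤ r →
        ∃ (N : ℕ) (F : Fin N → Σ n : ℕ, SimpleGraph (Fin n)),
          c ^ (r ^ 3) ≤ (N : ℝ) ∧
          (∀ i j : Fin N, i ≠ j → IsEmpty ((F i).2 ≃g (F j).2)) ∧
          (∀ i j : Fin N, i ≠ j → ¬ HasMinorOf (F i).2 (F j).2) ∧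
          (∀ i, ((F i).2).Connected) ∧
          (∀ i, HasMinorOf (completeGraph (Fin r)) (F i).2) ∧
          (∀ i, ((F i).1 : ℝ) ≤ C * (r : ℝ) ^ 2 * Real.log r) := by
  refine ⟨2, 192 / Real.log 2, by norm_num, div_pos (by norm_num) (Real.log_pos (by norm_num)), ?_⟩
  intro r hr
  classical
  obtain ⟨k, hk⟩ : ∃ k, k = 64 * r ^ 2 := ⟨_, rfl⟩
  obtain ⟨n, hn⟩ : ∃ n, n = 192 * r ^ 2 := ⟨_, rfl⟩
  have hr2 : r ≤ r ^ 2 := Nat.le_self_pow (by norm_num) r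
  have hkr : r ≤ k := by omega
  have hkpos : 0 < k := by omega
  have hcard : Fintype.card (Fin n) = Fintype.card (Fin k ⊕ Fin k × Bool) := by
    simp; omega
  let e : Fin n ≃ (Fin k ⊕ Fin k × Bool) := Fintype.equivOfCardEq hcard
  let H : (Fin k → Fin k → Bool) → SimpleGraph (Fin n) := fun f => (baseGraph k f).comap e
  have hHadj : ∀ f u v, (H f).Adj u v ↔ (baseGraph k f).Adj (e u) (e v) := fun f u v => Iff.rfl
  have hHinj : Function.Injective H := by
    intro f g hfg
    apply baseGraph_inj k
    ext u v
    have := hHadj f (e.symm u) (e.symm v)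
    rw [hfg, hHadj] at this
    simpa using this.symm
  have hcount : ∀ f g, (∑ u, ∑ v, if (H f).Adj u v then 1 else 0 : ℕ) =
      ∑ u, ∑ v, if (H g).Adj u v then 1 else 0 := by
    have : ∀ f, (∑ u, ∑ v, if (H f).Adj u v then 1 else 0 : ℕ) =
      ∑ u, ∑ v, if (baseGraph k f).Adj u v then 1 else 0 := by
      intro f
      rw [← Equiv.sum_comp e]
      refine Finset.sum_congr rfl fun u _ => ?_
      rw [← Equiv.sum_comp e]
      rfl
    intro f g
    rw [this, this, baseGraph_count k f g]
  have hiso : ∀ f g, HasMinorOf (H f) (H g) → Nonempty (H f ≃g H g) := by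
    intro f g h
    obtain ⟨σ, hσ⟩ := minor_perm h
    exact iso_of_perm σ hσ (hcount f g)
  let S : Setoid (Fin k → Fin k → Bool) :=
    ⟨fun f g => Nonempty (H f ≃g H g), fun f => ⟨Iso.refl⟩, fun ⟨a⟩ => ⟨a.symm⟩,
      fun ⟨a⟩ ⟨b⟩ => ⟨a.trans b⟩⟩
  let Q := Quotient S
  have hout : ∀ f : Fin k → Fin k → Bool, Nonempty (H f ≃g H (Quotient.mk S f).out) := by
    intro f
    exact Quotient.exact (Quotient.out_eq (Quotient.mk S f)).symm
  let τ : ∀ f : Fin k → Fin k → Bool, H f ≃g H (Quotient.mk S f).out := fun f => (hout f).some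
  have hinj : Function.Injective
      (fun f => ((Quotient.mk S f, (τ f).toEquiv) : Q × Equiv.Perm (Fin n))) := by
    intro f g hfg
    simp only [Prod.mk.injEq] at hfg
    obtain ⟨h1, h2⟩ := hfg
    apply hHinj
    ext u v
    have a1 : (H (Quotient.mk S f).out).Adj ((τ f).toEquiv u) ((τ f).toEquiv v) ↔ (H f).Adj u v :=
      (τ f).map_rel_iff
    have a2 : (H (Quotient.mk S g).out).Adj ((τ g).toEquiv u) ((τ g).toEquiv v) ↔ (H g).Adj u v :=
      (τ g).map_rel_iff
    rw [← a1, ← a2, h2, h1]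
  have hle := Fintype.card_le_of_injective _ hinj
  have hN : 2 ^ (r ^ 3) ≤ Fintype.card Q := by
    have hb := num_bound r hr
    rw [← hk, ← hn] at hb
    rw [Fintype.card_prod, Fintype.card_perm, Fintype.card_fin] at hle
    have hc : Fintype.card (Fin k → Fin k → Bool) = 2 ^ (k * k) := by
      simp [pow_mul]
    rw [hc] at hle
    exact Nat.le_of_mul_le_mul_right (hb.trans hle) (Nat.factorial_pos n)
  let q : Fin (Fintype.card Q) ≃ Q := (Fintype.equivFin Q).symm
  have hne : ∀ i j, i ≠ j → IsEmpty (H (q i).out ≃g H (q j).out) := by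
    intro i j hij
    refine ⟨fun a => hij ?_⟩
    apply q.injective
    exact Quotient.out_equiv_out.1 (show S.r _ _ from ⟨a⟩)
  refine ⟨Fintype.card Q, fun i => ⟨n, H (q i).out⟩, by exact_mod_cast hN, hne, ?_, ?_, ?_, ?_⟩
  · intro i j hij hm
    obtain ⟨a⟩ := hiso _ _ hm
    exact (hne i j hij).false a
  · intro i
    exact (Iso.connected_iff (Iso.comap e (baseGraph k (q i).out))).2 (baseGraph_conn k hkpos _)
  · intro i
    have hinj' : Function.Injective (fun a : Fin r =>
        e.symm (Sum.inr (Fin.castLE hkr a, true))) := by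
      intro a b hab
      simpa using hab
    refine ⟨fun a => {e.symm (Sum.inr (Fin.castLE hkr a, true))}, ?_, ?_, ?_⟩
    · intro a
      have : Nonempty ({e.symm (Sum.inr (Fin.castLE hkr a, true))} : Set (Fin n)) := ⟨⟨_, rfl⟩⟩
      refine Connected.mk fun u v => ?_
      rw [Subsingleton.elim u v]
    · intro a b hab
      exact Set.disjoint_singleton.2 (hinj'.ne hab)
    · intro a b hab
      refine ⟨_, rfl, _, rfl, ?_⟩
      rw [hHadj]
      simp only [Equiv.apply_symm_apply]
      show (Fin.castLE hkr a, true) ≠ (Fin.castLE hkr b, true)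
      have : a ≠ b := hab.ne
      simpa using this
  · intro i
    show (n : ℝ) ≤ _
    rw [hn]
    push_cast
    have hl : 0 < Real.log 2 := Real.log_pos (by norm_num)
    have hlr : Real.log 2 ≤ Real.log r := Real.log_le_log (by norm_num) (by exact_mod_cast hr)
    have : 192 / Real.log 2 * (r : ℝ) ^ 2 * Real.log r = 192 * (r : ℝ) ^ 2 * (Real.log r / Real.log 2) := by
      field_simp
    rw [this]
    exact le_mul_of_one_le_right (by positivity) ((one_le_div hl).2 hlr)
end

section
/- Let ξ(d) denote the number of isomorphism classes of d-regular graphs on d² vertices. Then ξ(d) = Ω(d^{d³/8}) over even d: there exist a constant c > 0 and an integer d₀ ≥ 2 such that for every even integer d ≥ d₀, ξ(d) ≥ c · d^{d³/8}. -/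
open SimpleGraph

/-- The `d`-regular graphs on `d²` vertices. -/
def RegGraphs (d : ℕ) : Type :=
  {G : SimpleGraph (Fin (d ^ 2)) // ∀ v, (G.neighborSet v).ncard = d}

/-- Isomorphism as an equivalence relation on `d`-regular graphs on `d²` vertices. -/
def regSetoid (d : ℕ) : Setoid (RegGraphs d) where
  r G H := Nonempty (G.1 ≃g H.1)
  iseqv := by
    refine ⟨fun G => ⟨RelIso.refl _⟩, ?_, ?_⟩
    · intro G H h
      obtain ⟨e⟩ := h
      exact ⟨e.symm⟩
    · intro G H K h h'
      obtain ⟨e⟩ := h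
      obtain ⟨f⟩ := h'
      exact ⟨e.trans f⟩

/-- `ξ(d)`: the number of isomorphism classes of `d`-regular graphs on `d²`
vertices. -/
noncomputable def xi (d : ℕ) : ℕ := Nat.card (Quotient (regSetoid d))

def cellGraph (d k : ℕ) (σ : Fin d → Fin d → Equiv.Perm (Fin k)) :
    SimpleGraph ((Fin d × Fin k) ⊕ (Fin d × Fin k)) where
  Adj a b := match a, b with
    | Sum.inl p, Sum.inr q => σ p.1 q.1 p.2 = q.2
    | Sum.inr q, Sum.inl p => σ p.1 q.1 p.2 = q.2
    | _, _ => False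
  symm := ⟨by rintro (a | a) (b | b) h <;> simp_all⟩
  loopless := ⟨by rintro (a | a) h <;> exact h⟩

lemma cellGraph_deg (d k : ℕ) (σ : Fin d → Fin d → Equiv.Perm (Fin k)) (v) :
    ((cellGraph d k σ).neighborSet v).ncard = d := by
  rcases v with ⟨i, x⟩ | ⟨j, y⟩
  · have : (cellGraph d k σ).neighborSet (Sum.inl (i, x)) =
        Set.range (fun j : Fin d => (Sum.inr (j, σ i j x) : (Fin d × Fin k) ⊕ (Fin d × Fin k))) := by
      ext w
      rcases w with ⟨j, y⟩ | ⟨j, y⟩ <;> simp [cellGraph, SimpleGraph.neighborSet]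
    rw [this, Set.ncard_range_of_injective]
    · simp
    · intro a b h
      simp at h
      exact h.1
  · have : (cellGraph d k σ).neighborSet (Sum.inr (j, y)) =
        Set.range (fun i : Fin d =>
          (Sum.inl (i, (σ i j).symm y) : (Fin d × Fin k) ⊕ (Fin d × Fin k))) := by
      ext w
      rcases w with ⟨i, x⟩ | ⟨i, x⟩
      · simp only [cellGraph, SimpleGraph.neighborSet, Set.mem_setOf_eq, Set.mem_range,
          Sum.inl.injEq, Prod.mk.injEq, exists_eq_left, Equiv.symm_apply_eq]
        exact eq_comm
      · simp [cellGraph, SimpleGraph.neighborSet]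
    rw [this, Set.ncard_range_of_injective]
    · simp
    · intro a b h
      simp at h
      exact h.1

lemma cellGraph_inj (d k : ℕ) : Function.Injective (cellGraph d k) := by
  intro σ τ h
  funext i j
  ext1 x
  have h1 : (cellGraph d k σ).Adj (Sum.inl (i, x)) (Sum.inr (j, σ i j x)) := by
    simp [cellGraph]
  rw [h] at h1
  exact Eq.symm h1

lemma card_bound (d k : ℕ) (hd : d = 2 * k) :
    (Nat.factorial k) ^ (d ^ 2) ≤ xi d * Nat.factorial (d ^ 2) := by
  classical
  have hc : Fintype.card ((Fin d × Fin k) ⊕ (Fin d × Fin k)) = Fintype.card (Fin (d ^ 2)) := by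
    simp; subst hd; ring
  let e := Fintype.equivOfCardEq hc
  let F : (Fin d → Fin d → Equiv.Perm (Fin k)) → RegGraphs d := fun σ =>
    ⟨(cellGraph d k σ).comap e.symm, fun v => by
      have : ((cellGraph d k σ).comap e.symm).neighborSet v =
          e '' ((cellGraph d k σ).neighborSet (e.symm v)) := by
        ext w
        simp [SimpleGraph.neighborSet, Equiv.image_eq_preimage_symm]
      rw [this, Set.ncard_image_of_injective _ e.injective, cellGraph_deg]⟩
  have hF : Function.Injective F := by
    intro σ τ h
    have h' : (cellGraph d k σ).comap e.symm = (cellGraph d k τ).comap e.symm :=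
      congrArg Subtype.val h
    apply cellGraph_inj d k
    ext a b
    have h2 : ((cellGraph d k σ).comap e.symm).Adj (e a) (e b) ↔
        ((cellGraph d k τ).comap e.symm).Adj (e a) (e b) := by rw [h']
    simpa using h2
  have hex : ∀ G : RegGraphs d,
      Nonempty ((Quotient.out (Quotient.mk (regSetoid d) G)).1 ≃g G.1) := fun G =>
    Quotient.exact (s := regSetoid d) (Quotient.out_eq _)
  let Φ : (Fin d → Fin d → Equiv.Perm (Fin k)) →
      Quotient (regSetoid d) × Equiv.Perm (Fin (d ^ 2)) := fun σ =>
    (Quotient.mk (regSetoid d) (F σ), (hex (F σ)).some.toEquiv)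
  have hΦ : Function.Injective Φ := by
    intro σ τ h
    apply hF
    have h1 : Quotient.mk (regSetoid d) (F σ) = Quotient.mk (regSetoid d) (F τ) :=
      congrArg Prod.fst h
    have h2 : (hex (F σ)).some.toEquiv = (hex (F τ)).some.toEquiv := congrArg Prod.snd h
    generalize (hex (F σ)).some = f at h2
    generalize (hex (F τ)).some = g at h2
    revert f g
    rw [h1]
    intro f g h2
    apply Subtype.ext
    ext a b
    obtain ⟨a, rfl⟩ := f.toEquiv.surjective a
    obtain ⟨b, rfl⟩ := f.toEquiv.surjective b
    have e1 : (F σ).1.Adj (f.toEquiv a) (f.toEquiv b) ↔ _ := f.map_rel_iff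
    have e2 : (F τ).1.Adj (g.toEquiv a) (g.toEquiv b) ↔ _ := g.map_rel_iff
    rw [e1, h2, e2]
  haveI : Finite (RegGraphs d) := by unfold RegGraphs; infer_instance
  have := Nat.card_le_card_of_injective Φ hΦ
  rw [Nat.card_prod] at this
  have h3 : Nat.card (Fin d → Fin d → Equiv.Perm (Fin k)) = (Nat.factorial k) ^ (d ^ 2) := by
    simp [Fintype.card_perm, ← pow_mul, pow_two]
  have h4 : Nat.card (Equiv.Perm (Fin (d ^ 2))) = Nat.factorial (d ^ 2) := by
    simp [Fintype.card_perm]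
  rw [h3, h4] at this
  exact this

lemma fact_bound (k : ℕ) (hk : 18 ≤ k) :
    ((2 * k : ℕ) : ℝ) ^ ((k : ℝ) / 4) * ((2 * k : ℕ) : ℝ) ^ 2 ≤ (Nat.factorial k : ℝ) := by
  have hk' : (18 : ℝ) ≤ k := by exact_mod_cast hk
  have h1 : (k : ℝ) ^ k / (Nat.factorial k : ℝ) ≤ Real.exp k :=
    Real.pow_div_factorial_le_exp _ (by positivity) _
  have h2 : Real.exp k ≤ 3 ^ k := by
    rw [← mul_one (k : ℝ), Real.exp_nat_mul]
    exact pow_le_pow_left₀ (Real.exp_pos _).le (by linarith [Real.exp_one_lt_d9]) _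
  have h3 : ((k : ℝ) / 3) ^ k ≤ (Nat.factorial k : ℝ) := by
    have hf : (0 : ℝ) < Nat.factorial k := by positivity
    rw [div_pow, div_le_iff₀ (by positivity)]
    rw [div_le_iff₀ hf] at h1
    nlinarith
  refine le_trans ?_ h3
  push_cast
  have h4 : (2 * (k : ℝ)) ^ ((1 : ℝ) / 2) ≤ k / 3 := by
    rw [← Real.sqrt_eq_rpow]
    apply Real.sqrt_le_iff.2
    constructor
    · positivity
    · nlinarith
  calc (2 * (k : ℝ)) ^ ((k : ℝ) / 4) * (2 * (k : ℝ)) ^ 2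
      = (2 * (k : ℝ)) ^ ((k : ℝ) / 4 + 2) := by
        rw [Real.rpow_add (by positivity)]; norm_num
    _ ≤ (2 * (k : ℝ)) ^ ((1 : ℝ) / 2 * k) :=
        Real.rpow_le_rpow_of_exponent_le (by linarith) (by linarith)
    _ = ((2 * (k : ℝ)) ^ ((1 : ℝ) / 2)) ^ k := by
        rw [Real.rpow_mul (by positivity), Real.rpow_natCast]
    _ ≤ ((k : ℝ) / 3) ^ k := pow_le_pow_left₀ (by positivity) h4 _

/-- `ξ(d) = Ω(d^{d³/8})` over even `d`. -/
theorem xi_lower_bound :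
    ∃ (c : ℝ) (d₀ : ℕ), 0 < c ∧ 2 ≤ d₀ ∧
      ∀ d : ℕ, d₀ ≤ d → Even d →
        c * (d : ℝ) ^ ((d : ℝ) ^ 3 / 8) ≤ (xi d : ℝ) := by
  refine ⟨1, 36, one_pos, by norm_num, ?_⟩
  intro d hd hev
  obtain ⟨k, hk⟩ := hev
  have hdk : d = 2 * k := by omega
  have h1 := card_bound d k hdk
  have h2 := fact_bound k (by omega)
  rw [← hdk] at h2
  have hd0 : (0 : ℝ) < d := by exact_mod_cast (by omega : 0 < d)
  have h3 : (Nat.factorial (d ^ 2) : ℝ) ≤ ((d : ℝ) ^ 2) ^ (d ^ 2) := by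
    exact_mod_cast Nat.factorial_le_pow (d ^ 2)
  have h1' : (Nat.factorial k : ℝ) ^ (d ^ 2) ≤ xi d * (Nat.factorial (d ^ 2) : ℝ) := by
    exact_mod_cast h1
  have h4 := pow_le_pow_left₀ (by positivity) h2 (d ^ 2)
  rw [mul_pow] at h4
  have h5 : ((d : ℝ) ^ ((k : ℝ) / 4)) ^ (d ^ 2) = (d : ℝ) ^ ((d : ℝ) ^ 3 / 8) := by
    rw [← Real.rpow_natCast, ← Real.rpow_mul hd0.le]
    congr 1
    have : (d : ℝ) = 2 * k := by exact_mod_cast hdk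
    push_cast
    rw [this]; ring
  rw [h5] at h4
  have h6 : (xi d : ℝ) * (Nat.factorial (d ^ 2) : ℝ) ≤ xi d * ((d : ℝ) ^ 2) ^ (d ^ 2) :=
    mul_le_mul_of_nonneg_left h3 (Nat.cast_nonneg _)
  rw [one_mul]
  exact le_of_mul_le_mul_right (h4.trans (h1'.trans h6)) (by positivity)
end
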